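/- Let u ∈ C²(closure(B₁)) with 0 ≤ u < 1 be a stable solution of −Δu = f(u) in the unit ball B₁ ⊂ ℝⁿ, where f ∈ C²([0,1)) satisfies f ≥ 0, f′ ≥ 0, F(1) = +∞, f′ > 0 near 1, and γ̲ := liminf_{t→1⁻} f(t)f″(t)/f′(t)² > 0. If n < 4 + 2√γ̲, then there is a constant C, depending only on n and f, such that F(u(x)) ≤ C‖u‖²_{L¹(B₁)} for every x ∈ B_{1/2}; in particular u < 1 on B_{1/2} with a quantitative bound. -/

import Mathlib

open MeasureTheory Set Filter Topology Bornology Metric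

/-- The Laplacian of `u : ℝⁿ → ℝ`, as the sum of second partial derivatives. -/
noncomputable def lap {n : ℕ} (u : EuclideanSpace ℝ (Fin n) → ℝ)
    (x : EuclideanSpace ℝ (Fin n)) : ℝ :=
  ∑ i, fderiv ℝ (fun y => fderiv ℝ u y (EuclideanSpace.single i 1)) x (EuclideanSpace.single i 1)

/-- `f` is of class `C²([0,1))`, with first and second derivatives `f'`, `f''`. -/
def C2On01 (f f' f'' : ℝ → ℝ) : Prop :=
  (∀ t ∈ Ico (0:ℝ) 1, HasDerivWithinAt f (f' t) (Ico (0:ℝ) 1) t) ∧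
  (∀ t ∈ Ico (0:ℝ) 1, HasDerivWithinAt f' (f'' t) (Ico (0:ℝ) 1) t) ∧
  ContinuousOn f'' (Ico (0:ℝ) 1)

/-- Stability of a solution `u` of `-Δu = f(u)` in `Ω`: nonnegativity of the second variation of
the energy on all smooth test functions compactly supported in `Ω`. Here `f'` is the derivative
of the nonlinearity. -/
def StableSol {n : ℕ} (f' : ℝ → ℝ) (u : EuclideanSpace ℝ (Fin n) → ℝ)
    (Ω : Set (EuclideanSpace ℝ (Fin n))) : Prop :=
  ∀ ξ : EuclideanSpace ℝ (Fin n) → ℝ, ContDiff ℝ (⊤:ℕ∞) ξ → HasCompactSupport ξ →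
    tsupport ξ ⊆ Ω →
    0 ≤ ∫ x in Ω, (‖gradient ξ x‖ ^ 2 - f' (u x) * ξ x ^ 2)

/-- The `i`-th partial derivative of `u`. -/
noncomputable def partialDeriv {n : ℕ} (i : Fin n) (u : EuclideanSpace ℝ (Fin n) → ℝ)
    (x : EuclideanSpace ℝ (Fin n)) : ℝ :=
  fderiv ℝ u x (EuclideanSpace.single i 1)

lemma lap_eq_sum_partialDeriv {n : ℕ} (u : EuclideanSpace ℝ (Fin n) → ℝ)
    (x : EuclideanSpace ℝ (Fin n)) :
    lap u x = ∑ i, partialDeriv i (partialDeriv i u) x := rfl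

lemma norm_gradient_sq {n : ℕ} (u : EuclideanSpace ℝ (Fin n) → ℝ)
    (x : EuclideanSpace ℝ (Fin n)) :
    ‖gradient u x‖ ^ 2 = ∑ i, partialDeriv i u x ^ 2 := by
  rw [EuclideanSpace.real_norm_sq_eq]
  refine Finset.sum_congr rfl fun i _ => ?_
  congr 1
  have h : inner ℝ (gradient u x) (EuclideanSpace.single i (1 : ℝ)) = partialDeriv i u x := by
    simp [gradient, partialDeriv]
  rw [← h, EuclideanSpace.inner_single_right]
  simp

lemma integrable_of_continuousOn_of_eq_zero {n : ℕ} {g : EuclideanSpace ℝ (Fin n) → ℝ}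
    {K : Set (EuclideanSpace ℝ (Fin n))} (hK : IsCompact K) (hg : ContinuousOn g K)
    (h0 : ∀ x, x ∉ K → g x = 0) : Integrable g := by
  have h := hg.integrableOn_compact (μ := volume) hK
  rwa [integrableOn_iff_integrable_of_support_subset] at h
  intro x hx
  by_contra hxK
  exact hx (h0 x hxK)

lemma partialDeriv_eq_zero_of_notMem_tsupport {n : ℕ} {b : EuclideanSpace ℝ (Fin n) → ℝ}
    (i : Fin n) {x : EuclideanSpace ℝ (Fin n)} (hx : x ∉ tsupport b) :
    partialDeriv i b x = 0 := by
  have : fderiv ℝ b x = 0 := by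
    by_contra h
    exact hx (support_fderiv_subset ℝ h)
  simp [partialDeriv, this]

lemma tsupport_partialDeriv_subset {n : ℕ} (b : EuclideanSpace ℝ (Fin n) → ℝ) (i : Fin n) :
    tsupport (partialDeriv i b) ⊆ tsupport b := by
  refine closure_minimal (fun x hx => ?_) (isClosed_tsupport b)
  by_contra h
  exact hx (partialDeriv_eq_zero_of_notMem_tsupport i h)

lemma ContDiffOn.partialDeriv {n : ℕ} {Ω : Set (EuclideanSpace ℝ (Fin n))} (hΩ : IsOpen Ω)
    {u : EuclideanSpace ℝ (Fin n) → ℝ} {k m : WithTop ℕ∞} (hu : ContDiffOn ℝ k u Ω)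
    (hm : m + 1 ≤ k) (i : Fin n) : ContDiffOn ℝ m (partialDeriv i u) Ω :=
  (hu.fderiv_of_isOpen hΩ hm).clm_apply contDiffOn_const

lemma ContDiff.partialDeriv {n : ℕ} {u : EuclideanSpace ℝ (Fin n) → ℝ} {k m : WithTop ℕ∞}
    (hu : ContDiff ℝ k u) (hm : m + 1 ≤ k) (i : Fin n) : ContDiff ℝ m (partialDeriv i u) :=
  contDiffOn_univ.1 (ContDiffOn.partialDeriv isOpen_univ hu.contDiffOn hm i)

lemma partialDeriv_mul {n : ℕ} {a b : EuclideanSpace ℝ (Fin n) → ℝ}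
    {x : EuclideanSpace ℝ (Fin n)} (ha : DifferentiableAt ℝ a x) (hb : DifferentiableAt ℝ b x)
    (i : Fin n) :
    partialDeriv i (fun y => a y * b y) x =
      partialDeriv i a x * b x + a x * partialDeriv i b x := by
  simp only [partialDeriv]
  rw [fderiv_fun_mul ha hb]
  simp
  ring

lemma integral_partialDeriv_mul_add {n : ℕ} {Ω : Set (EuclideanSpace ℝ (Fin n))} (hΩ : IsOpen Ω)
    {a b : EuclideanSpace ℝ (Fin n) → ℝ} (ha : ContDiffOn ℝ 1 a Ω) (hb : ContDiff ℝ 1 b)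
    (hc : HasCompactSupport b) (hs : tsupport b ⊆ Ω) (i : Fin n) :
    Integrable (fun x => partialDeriv i a x * b x) ∧
    Integrable (fun x => a x * partialDeriv i b x) ∧
    ∫ x, a x * partialDeriv i b x = - ∫ x, partialDeriv i a x * b x := by
  have ha' : ContinuousOn (partialDeriv i a) Ω :=
    (ContDiffOn.partialDeriv hΩ ha (m := 0) (by norm_num) i).continuousOn
  have hb' : Continuous (partialDeriv i b) :=
    (ContDiff.partialDeriv hb (m := 0) (by norm_num) i).continuous
  have i1 : Integrable (fun x => partialDeriv i a x * b x) := by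
    refine integrable_of_continuousOn_of_eq_zero (K := tsupport b) hc
      ((ha'.mono hs).mul hb.continuous.continuousOn) fun x hx => ?_
    simp [image_eq_zero_of_notMem_tsupport hx]
  have i2 : Integrable (fun x => a x * partialDeriv i b x) := by
    refine integrable_of_continuousOn_of_eq_zero (K := tsupport b) hc
      ((ha.continuousOn.mono hs).mul hb'.continuousOn) fun x hx => ?_
    simp [partialDeriv_eq_zero_of_notMem_tsupport i hx]
  have i3 : Integrable (fun x => a x * b x) := by
    refine integrable_of_continuousOn_of_eq_zero (K := tsupport b) hc
      ((ha.continuousOn.mono hs).mul hb.continuous.continuousOn) fun x hx => ?_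
    simp [image_eq_zero_of_notMem_tsupport hx]
  refine ⟨i1, i2, ?_⟩
  exact integral_bilinear_hasFDerivAt_right_eq_neg_left_of_integrable
    (B := ContinuousLinearMap.mul ℝ ℝ) (f' := fun x => fderiv ℝ a x) (g' := fun x => fderiv ℝ b x)
    i1 i2 i3
    (fun x hx => ((ha.differentiableOn one_ne_zero).differentiableAt
      (hΩ.mem_nhds (hs hx))).hasFDerivAt)
    (fun x _ => (hb.differentiable one_ne_zero x).hasFDerivAt)

/-- Chain rule for a function which is only one-sidedly differentiable at `0`. -/
lemma contDiffOn_comp_Ico {n : ℕ} {Ω : Set (EuclideanSpace ℝ (Fin n))} (hΩ : IsOpen Ω)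
    {u : EuclideanSpace ℝ (Fin n) → ℝ} (hu : ContDiffOn ℝ 1 u Ω)
    (hmaps : MapsTo u Ω (Ico 0 1)) {g g' : ℝ → ℝ}
    (hg : ∀ t ∈ Ico (0 : ℝ) 1, HasDerivWithinAt g (g' t) (Ico (0 : ℝ) 1) t)
    (hg' : ContinuousOn g' (Ico 0 1)) :
    ContDiffOn ℝ 1 (fun x => g (u x)) Ω ∧
      ∀ x ∈ Ω, ∀ i, partialDeriv i (fun y => g (u y)) x = g' (u x) * partialDeriv i u x := by
  have hd : ∀ x ∈ Ω, HasFDerivAt (fun y => g (u y)) (g' (u x) • fderiv ℝ u x) x := by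
    intro x hx
    have h1 : HasFDerivWithinAt u (fderiv ℝ u x) Ω x :=
      ((hu.differentiableOn one_ne_zero).differentiableAt
        (hΩ.mem_nhds hx)).hasFDerivAt.hasFDerivWithinAt
    exact ((hg (u x) (hmaps hx)).comp_hasFDerivWithinAt x h1 hmaps).hasFDerivAt (hΩ.mem_nhds hx)
  refine ⟨?_, fun x hx i => ?_⟩
  · have hU : UniqueDiffOn ℝ (Ico (0 : ℝ) 1) := uniqueDiffOn_Ico 0 1
    have hgc : ContDiffOn ℝ 1 g (Ico 0 1) := by
      rw [show (1 : WithTop ℕ∞) = 0 + 1 by norm_num, contDiffOn_succ_iff_derivWithin hU]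
      refine ⟨fun t ht => (hg t ht).differentiableWithinAt, by simp, ?_⟩
      rw [contDiffOn_zero]
      exact hg'.congr fun t ht => (hg t ht).derivWithin (hU t ht)
    exact hgc.comp hu hmaps
  · simp [partialDeriv, (hd x hx).fderiv]

/-- Smooth approximation in the `C¹` sense, with control of the supports. -/
lemma exists_smooth_approx {n : ℕ} {ξ : EuclideanSpace ℝ (Fin n) → ℝ} (hξ : ContDiff ℝ 1 ξ)
    (hc : HasCompactSupport ξ) {δ ε : ℝ} (hδ : 0 < δ) (hε : 0 < ε) :
    ∃ g : EuclideanSpace ℝ (Fin n) → ℝ, ContDiff ℝ (⊤ : ℕ∞) g ∧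
      tsupport g ⊆ cthickening δ (tsupport ξ) ∧
      ∀ x, |g x - ξ x| ≤ ε ∧ ∀ i, |partialDeriv i g x - partialDeriv i ξ x| ≤ ε := by
  have hξ' : Continuous (fderiv ℝ ξ) := hξ.continuous_fderiv one_ne_zero
  have hu1 : UniformContinuous ξ :=
    hc.uniformContinuous_of_continuous hξ.continuous
  have hu2 : UniformContinuous (fderiv ℝ ξ) :=
    (hc.fderiv ℝ).uniformContinuous_of_continuous hξ'
  obtain ⟨r1, hr1, h1⟩ := Metric.uniformContinuous_iff.1 hu1 ε hε
  obtain ⟨r2, hr2, h2⟩ := Metric.uniformContinuous_iff.1 hu2 ε hε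
  set r := min δ (min r1 r2) with hr
  have hr0 : 0 < r := by positivity
  let φ : ContDiffBump (0 : EuclideanSpace ℝ (Fin n)) := ⟨r / 2, r, by positivity, by linarith⟩
  let g := convolution (φ.normed volume) ξ (ContinuousLinearMap.lsmul ℝ ℝ) volume
  have hli : LocallyIntegrable (φ.normed volume : EuclideanSpace ℝ (Fin n) → ℝ) :=
    φ.continuous_normed.locallyIntegrable
  have hd : ∀ x, fderiv ℝ g x =
      convolution (φ.normed volume) (fderiv ℝ ξ) (ContinuousLinearMap.lsmul ℝ ℝ) volume x := by
    intro x
    exact (hc.hasFDerivAt_convolution_right (ContinuousLinearMap.lsmul ℝ ℝ) hli hξ x).fderiv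
  refine ⟨g, ?_, ?_, fun x => ⟨?_, fun i => ?_⟩⟩
  · exact φ.hasCompactSupport_normed.contDiff_convolution_left _ φ.contDiff_normed
      hξ.continuous.locallyIntegrable
  · refine closure_minimal ?_ isClosed_cthickening
    refine (support_convolution_subset (ContinuousLinearMap.lsmul ℝ ℝ)).trans ?_
    rw [φ.support_normed_eq]
    rintro _ ⟨y, hy, z, hz, rfl⟩
    refine mem_cthickening_of_dist_le _ z δ _ (subset_tsupport _ hz) ?_
    have : ‖y‖ < r := by simpa using hy
    have h3 : r ≤ δ := min_le_left _ _
    simp only [dist_eq_norm, add_sub_cancel_right]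
    linarith
  · rw [← Real.dist_eq]
    refine φ.dist_normed_convolution_le hξ.continuous.aestronglyMeasurable fun y hy => ?_
    refine (h1 (lt_of_lt_of_le (mem_ball.1 hy) ?_)).le
    exact (min_le_right _ _).trans (min_le_left _ _)
  · have h4 : dist (fderiv ℝ g x) (fderiv ℝ ξ x) ≤ ε := by
      rw [hd]
      refine φ.dist_normed_convolution_le hξ'.aestronglyMeasurable fun y hy => ?_
      refine (h2 (lt_of_lt_of_le (mem_ball.1 hy) ?_)).le
      exact (min_le_right _ _).trans (min_le_right _ _)
    rw [dist_eq_norm] at h4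
    have h5 := (fderiv ℝ g x - fderiv ℝ ξ x).le_opNorm (EuclideanSpace.single i 1)
    simp only [PiLp.norm_single, norm_one, mul_one] at h5
    exact h5.trans h4

lemma StableSol.nonneg_of_contDiff_one {n : ℕ} {f' : ℝ → ℝ} {u : EuclideanSpace ℝ (Fin n) → ℝ}
    {Ω : Set (EuclideanSpace ℝ (Fin n))} (hΩ : IsOpen Ω) (hst : StableSol f' u Ω)
    (hcont : ContinuousOn (fun x => f' (u x)) Ω)
    {ξ : EuclideanSpace ℝ (Fin n) → ℝ} (hξ : ContDiff ℝ 1 ξ)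
    (hc : HasCompactSupport ξ) (hs : tsupport ξ ⊆ Ω) :
    0 ≤ ∫ x, (∑ i, partialDeriv i ξ x ^ 2 - f' (u x) * ξ x ^ 2) := by
  obtain ⟨δ, hδ, hδs⟩ := hc.exists_cthickening_subset_open hΩ hs
  set K := cthickening δ (tsupport ξ) with hKdef
  have hK : IsCompact K := hc.cthickening
  choose g hg1 hg2 hg3 using fun k : ℕ =>
    exists_smooth_approx hξ hc hδ (Nat.one_div_pos_of_nat (α := ℝ) (n := k))
  have hgK : ∀ k x, x ∉ K → g k x = 0 ∧ ∀ i, partialDeriv i (g k) x = 0 := fun k x hx =>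
    ⟨image_eq_zero_of_notMem_tsupport fun h => hx (hg2 k h),
      fun i => partialDeriv_eq_zero_of_notMem_tsupport i fun h => hx (hg2 k h)⟩
  have hpc : ∀ {h : EuclideanSpace ℝ (Fin n) → ℝ}, ContDiff ℝ 1 h → ∀ i,
      Continuous (partialDeriv i h) := fun hh i =>
    (ContDiff.partialDeriv hh (m := 0) (by norm_num) i).continuous
  have hcK : ContinuousOn (fun x => f' (u x)) K := hcont.mono hδs
  obtain ⟨A, hA⟩ := hK.exists_bound_of_continuousOn hcK
  obtain ⟨B, hB⟩ := hK.exists_bound_of_continuousOn hξ.continuous.continuousOn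
  choose P hP using fun i => hK.exists_bound_of_continuousOn (hpc hξ i).continuousOn
  have hk1 : ∀ k : ℕ, 1 / ((k : ℝ) + 1) ≤ 1 := fun k => by
    rw [div_le_one (by positivity)]; linarith [(Nat.cast_nonneg k : (0 : ℝ) ≤ k)]
  have htend : Tendsto (fun k : ℕ => 1 / ((k : ℝ) + 1)) atTop (𝓝 0) :=
    tendsto_one_div_add_atTop_nhds_zero_nat
  have hlim : Tendsto (fun k => ∫ x, (∑ i, partialDeriv i (g k) x ^ 2 - f' (u x) * g k x ^ 2))
      atTop (𝓝 (∫ x, (∑ i, partialDeriv i ξ x ^ 2 - f' (u x) * ξ x ^ 2))) := by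
    refine tendsto_integral_of_dominated_convergence
      (K.indicator fun _ => ∑ i, (P i + 1) ^ 2 + A * (B + 1) ^ 2) ?_ ?_ ?_ ?_
    · intro k
      refine (integrable_of_continuousOn_of_eq_zero hK ?_ ?_).aestronglyMeasurable
      · refine ContinuousOn.sub ?_ (hcK.mul ((hg1 k).continuous.pow 2).continuousOn)
        refine continuousOn_finsetSum _ fun i _ => ?_
        exact ((hpc ((hg1 k).of_le (by exact_mod_cast le_top)) i).pow 2).continuousOn
      · intro x hx
        simp [hgK k x hx]
    · rw [integrable_indicator_iff hK.measurableSet]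
      exact integrableOn_const hK.measure_lt_top.ne
    · intro k
      refine Eventually.of_forall fun x => ?_
      by_cases hx : x ∈ K
      · rw [indicator_of_mem hx]
        have e1 : ∀ i, partialDeriv i (g k) x ^ 2 ≤ (P i + 1) ^ 2 := fun i => by
          have h1 := ((hg3 k x).2 i).trans (hk1 k)
          have h2 := hP i x hx
          rw [Real.norm_eq_abs] at h2
          refine sq_le_sq' ?_ ?_ <;> linarith [abs_le.1 h1, abs_le.1 h2]
        have e2 : g k x ^ 2 ≤ (B + 1) ^ 2 := by
          have h1 := (hg3 k x).1.trans (hk1 k)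
          have h2 := hB x hx
          rw [Real.norm_eq_abs] at h2
          refine sq_le_sq' ?_ ?_ <;> linarith [abs_le.1 h1, abs_le.1 h2]
        have e3 := hA x hx
        rw [Real.norm_eq_abs] at e3
        refine (norm_sub_le _ _).trans (add_le_add ?_ ?_)
        · rw [Real.norm_eq_abs, abs_of_nonneg (Finset.sum_nonneg fun i _ => sq_nonneg _)]
          exact Finset.sum_le_sum fun i _ => e1 i
        · rw [Real.norm_eq_abs, abs_mul, abs_of_nonneg (sq_nonneg (g k x))]
          exact mul_le_mul e3 e2 (sq_nonneg _) ((abs_nonneg _).trans e3)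
      · simp [hgK k x hx, indicator_of_notMem hx]
    · refine Eventually.of_forall fun x => ?_
      have t1 : Tendsto (fun k => g k x) atTop (𝓝 (ξ x)) := by
        rw [tendsto_iff_dist_tendsto_zero]
        exact squeeze_zero (fun _ => dist_nonneg) (fun k => (hg3 k x).1) htend
      have t2 : ∀ i, Tendsto (fun k => partialDeriv i (g k) x) atTop (𝓝 (partialDeriv i ξ x)) := by
        intro i
        rw [tendsto_iff_dist_tendsto_zero]
        exact squeeze_zero (fun _ => dist_nonneg) (fun k => (hg3 k x).2 i) htend
      exact (tendsto_finsetSum _ fun i _ => (t2 i).pow 2).sub ((t1.pow 2).const_mul _)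
  refine ge_of_tendsto' hlim fun k => ?_
  have h := hst (g k) (hg1 k) (HasCompactSupport.of_support_subset_isCompact hK
    ((subset_tsupport _).trans (hg2 k))) ((hg2 k).trans hδs)
  rw [setIntegral_eq_integral_of_forall_compl_eq_zero] at h
  · simpa only [norm_gradient_sq] using h
  · intro x hx
    have hxK : x ∉ K := fun h => hx (hδs h)
    simp [norm_gradient_sq, hgK k x hxK]

lemma hasDerivWithinAt_integral_Ico {g : ℝ → ℝ} (hg : ContinuousOn g (Ico 0 1)) {t : ℝ}
    (ht : t ∈ Ico (0 : ℝ) 1) :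
    HasDerivWithinAt (fun t => ∫ s in (0 : ℝ)..t, g s) (g t) (Ico 0 1) t := by
  have hg2 : ContinuousOn (fun s => g (max s 0)) (Iio 1) := by
    refine hg.comp (by fun_prop) fun s hs => ⟨le_max_right _ _, max_lt hs one_pos⟩
  have hint : IntervalIntegrable (fun s => g (max s 0)) volume 0 t := by
    refine ContinuousOn.intervalIntegrable (hg2.mono fun s hs => ?_)
    rw [uIcc_of_le ht.1] at hs
    exact lt_of_le_of_lt hs.2 ht.2
  have hnhds : Iio (1 : ℝ) ∈ 𝓝 t := Iio_mem_nhds ht.2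
  have hd := intervalIntegral.integral_hasDerivAt_right hint
    (hg2.stronglyMeasurableAtFilter isOpen_Iio t ht.2) (hg2.continuousAt hnhds)
  simp only [max_eq_left ht.1] at hd
  have heq : ∀ r ∈ Ico (0 : ℝ) 1, ∫ s in (0 : ℝ)..r, g s = ∫ s in (0 : ℝ)..r, g (max s 0) := by
    intro r hr
    refine intervalIntegral.integral_congr fun s hs => ?_
    rw [uIcc_of_le hr.1] at hs
    simp [max_eq_left hs.1]
  exact hd.hasDerivWithinAt.congr heq (heq t ht)

lemma monotoneOn_Ico_of_hasDerivWithinAt {k k' : ℝ → ℝ} {t₀ : ℝ} (h0 : 0 ≤ t₀)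
    (hk : ∀ t ∈ Ico t₀ 1, HasDerivWithinAt k (k' t) (Ico (0 : ℝ) 1) t)
    (hk' : ∀ t ∈ Ico t₀ 1, 0 ≤ k' t) : MonotoneOn k (Ico t₀ 1) := by
  have hsub : Ico t₀ 1 ⊆ Ico (0 : ℝ) 1 := Ico_subset_Ico_left h0
  refine monotoneOn_of_hasDerivWithinAt_nonneg (f' := k') (convex_Ico _ _)
    (fun t ht => ((hk t ht).mono hsub).continuousWithinAt) (fun t ht => ?_) (fun t ht => ?_)
  · exact (hk t (interior_subset ht)).mono (interior_subset.trans hsub)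
  · exact hk' t (interior_subset ht)

/-- The exponent `a` and the threshold `t₀` beyond which the Crandall–Rabinowitz inequality holds
with a constant larger than `(a - 1)²`. -/
lemma exists_exponent_threshold {n : ℕ} {f f' f'' : ℝ → ℝ}
    (hf'pos : ∀ᶠ t in 𝓝[<] (1:ℝ), 0 < f' t)
    (hγ : ∃ γ : ℝ, 0 < γ ∧
      (γ : EReal) ≤ Filter.liminf (fun t => ((f t * f'' t / f' t ^ 2 : ℝ) : EReal)) (𝓝[<] (1:ℝ)) ∧
      (n : ℝ) < 4 + 2 * Real.sqrt γ) :
    ∃ a γ t₀ : ℝ, 1 < a ∧ (n : ℝ) < 2 * (1 + a) ∧ 0 < γ ∧ (a - 1) ^ 2 < γ ∧ t₀ ∈ Ico (0 : ℝ) 1 ∧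
      ∀ t ∈ Ico t₀ 1, 0 < f' t ∧ γ * f' t ^ 2 ≤ f t * f'' t := by
  obtain ⟨γ₀, hγ₀, hlim, hn⟩ := hγ
  have hs : 0 < √γ₀ := Real.sqrt_pos.2 hγ₀
  obtain ⟨a, ha1, ha2⟩ := exists_between (show max 1 ((n : ℝ) / 2 - 1) < 1 + √γ₀ from
    max_lt (by linarith) (by linarith))
  have ha0 := (le_max_left _ _).trans_lt ha1
  have ha3 := (le_max_right _ _).trans_lt ha1
  have hag : (a - 1) ^ 2 < γ₀ := by
    rw [← Real.sq_sqrt hγ₀.le]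
    exact pow_lt_pow_left₀ (by linarith) (by linarith) two_ne_zero
  obtain ⟨γ, hγ1, hγ2⟩ := exists_between hag
  have hγ0 : 0 < γ := (sq_nonneg _).trans_lt hγ1
  have hev : ∀ᶠ t in 𝓝[<] (1 : ℝ), (γ : EReal) < ((f t * f'' t / f' t ^ 2 : ℝ) : EReal) :=
    eventually_lt_of_lt_liminf (lt_of_lt_of_le (by exact_mod_cast hγ2) hlim)
  obtain ⟨l, hl, hl2⟩ := (mem_nhdsLT_iff_exists_Ioo_subset).1 (hev.and hf'pos)
  have hl1 : max l 0 < 1 := max_lt hl one_pos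
  obtain ⟨t₀, ht1, ht2⟩ := exists_between hl1
  refine ⟨a, γ, t₀, ha0, by linarith, hγ0, hγ1, ⟨((le_max_right _ _).trans_lt ht1).le, ht2⟩,
    fun t ht => ?_⟩
  obtain ⟨h1, h2⟩ := hl2 ⟨((le_max_left _ _).trans_lt ht1).trans_le ht.1, ht.2⟩
  refine ⟨h2, ?_⟩
  have h3 : γ < f t * f'' t / f' t ^ 2 := by exact_mod_cast h1
  rw [lt_div_iff₀ (by positivity)] at h3
  exact h3.le

lemma monotoneOn_of_C2On01 {f f' f'' : ℝ → ℝ} (hC2 : C2On01 f f' f'')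
    (hf'0 : ∀ t ∈ Ico (0:ℝ) 1, 0 ≤ f' t) : MonotoneOn f (Ico 0 1) :=
  monotoneOn_Ico_of_hasDerivWithinAt le_rfl hC2.1 hf'0

lemma C2On01.continuousOn {f f' f'' : ℝ → ℝ} (hC2 : C2On01 f f' f'') :
    ContinuousOn f (Ico 0 1) := fun t ht => (hC2.1 t ht).continuousWithinAt

lemma C2On01.continuousOn_deriv {f f' f'' : ℝ → ℝ} (hC2 : C2On01 f f' f'') :
    ContinuousOn f' (Ico 0 1) := fun t ht => (hC2.2.1 t ht).continuousWithinAt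

lemma C2On01.hasDerivWithinAt_rpow {f f' f'' : ℝ → ℝ} (hC2 : C2On01 f f' f'')
    (hf0 : ∀ t ∈ Ico (0:ℝ) 1, 0 ≤ f t) (b : ℝ) {t : ℝ} (ht : t ∈ Ico (0 : ℝ) 1) :
    HasDerivWithinAt (fun t => (f t + 1) ^ b) (b * (f t + 1) ^ (b - 1) * f' t) (Ico 0 1) t := by
  have h := ((hC2.1 t ht).add_const 1).rpow_const (p := b) (Or.inl (by linarith [hf0 t ht]))
  convert h using 1
  ring

lemma C2On01.continuousOn_rpow {f f' f'' : ℝ → ℝ} (hC2 : C2On01 f f' f'')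
    (hf0 : ∀ t ∈ Ico (0:ℝ) 1, 0 ≤ f t) (b : ℝ) :
    ContinuousOn (fun t => (f t + 1) ^ b) (Ico 0 1) :=
  fun _ ht => (hC2.hasDerivWithinAt_rpow hf0 b ht).continuousWithinAt

section Threshold

variable {f f' f'' : ℝ → ℝ} {γ t₀ : ℝ}

lemma mul_deriv_sq_le_succ_mul (hf0 : ∀ t ∈ Ico (0:ℝ) 1, 0 ≤ f t) (hγ : 0 < γ)
    (ht₀ : 0 ≤ t₀) (hCR : ∀ t ∈ Ico t₀ 1, 0 < f' t ∧ γ * f' t ^ 2 ≤ f t * f'' t) :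
    ∀ t ∈ Ico t₀ 1, 0 ≤ f'' t ∧ γ * f' t ^ 2 ≤ (f t + 1) * f'' t := by
  intro t ht
  obtain ⟨h1, h2⟩ := hCR t ht
  have h3 : 0 < f t * f'' t := lt_of_lt_of_le (by positivity) h2
  have h4 : 0 < f'' t := pos_of_mul_pos_right h3 (hf0 t ⟨ht₀.trans ht.1, ht.2⟩)
  exact ⟨h4.le, by linarith⟩

/-- Integrated Crandall–Rabinowitz condition: `f'` dominates a power of `f + 1`. -/
lemma exists_rpow_le_deriv (hC2 : C2On01 f f' f'') (hf0 : ∀ t ∈ Ico (0:ℝ) 1, 0 ≤ f t)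
    (hf'0 : ∀ t ∈ Ico (0:ℝ) 1, 0 ≤ f' t) (hγ : 0 < γ) (ht₀ : t₀ ∈ Ico (0 : ℝ) 1)
    (hCR : ∀ t ∈ Ico t₀ 1, 0 < f' t ∧ γ * f' t ^ 2 ≤ f t * f'' t) :
    ∃ C, 0 < C ∧ ∀ t ∈ Ico (0 : ℝ) 1, (f t + 1) ^ γ ≤ C * (f' t + 1) := by
  have hCR' := mul_deriv_sq_le_succ_mul hf0 hγ ht₀.1 hCR
  have hsub : ∀ {t}, t ∈ Ico t₀ 1 → t ∈ Ico (0 : ℝ) 1 := fun ht => ⟨ht₀.1.trans ht.1, ht.2⟩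
  have hpos : ∀ {t}, t ∈ Ico (0 : ℝ) 1 → 0 < f t + 1 := fun ht => by linarith [hf0 _ ht]
  have hmono : MonotoneOn (fun t => f' t * (f t + 1) ^ (-γ)) (Ico t₀ 1) := by
    refine monotoneOn_Ico_of_hasDerivWithinAt ht₀.1
      (fun t ht => (hC2.2.1 t (hsub ht)).mul (hC2.hasDerivWithinAt_rpow hf0 (-γ) (hsub ht)))
      fun t ht => ?_
    have e : (f t + 1) ^ (-γ) = (f t + 1) ^ (-γ - 1) * (f t + 1) := by
      rw [← Real.rpow_add_one (hpos (hsub ht)).ne']; ring_nf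
    have hp : 0 < (f t + 1) ^ (-γ - 1) := Real.rpow_pos_of_pos (hpos (hsub ht)) _
    have := mul_nonneg hp.le (sub_nonneg.2 (hCR' t ht).2)
    rw [e]
    linarith
  set c := f' t₀ * (f t₀ + 1) ^ (-γ) with hc
  have hm : t₀ ∈ Ico t₀ 1 := ⟨le_rfl, ht₀.2⟩
  have hc0 : 0 < c := mul_pos (hCR t₀ hm).1 (Real.rpow_pos_of_pos (hpos ht₀) _)
  have hq : 0 < (f t₀ + 1) ^ γ := Real.rpow_pos_of_pos (hpos ht₀) _
  refine ⟨c⁻¹ + (f t₀ + 1) ^ γ, by positivity, fun t ht => ?_⟩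
  have hf't := hf'0 t ht
  rcases le_or_gt t₀ t with h | h
  · have h1 : c ≤ f' t * (f t + 1) ^ (-γ) := hmono hm ⟨h, ht.2⟩ h
    have h2 : 0 < (f t + 1) ^ γ := Real.rpow_pos_of_pos (hpos ht) _
    rw [Real.rpow_neg (hpos ht).le, ← div_eq_mul_inv, le_div_iff₀ h2] at h1
    have h3 : (f t + 1) ^ γ ≤ c⁻¹ * f' t := by
      rw [inv_mul_eq_div, le_div_iff₀ hc0]; linarith
    have : 0 ≤ (f t₀ + 1) ^ γ * (f' t + 1) := by positivity
    have : 0 < c⁻¹ := by positivity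
    linarith
  · have h1 : (f t + 1) ^ γ ≤ (f t₀ + 1) ^ γ := by
      refine Real.rpow_le_rpow (hpos ht).le ?_ hγ.le
      linarith [monotoneOn_of_C2On01 hC2 hf'0 ht ht₀ h.le]
    have : 0 ≤ c⁻¹ * (f' t + 1) := by positivity
    have : 0 ≤ (f t₀ + 1) ^ γ * f' t := by positivity
    linarith

/-- `f²` is controlled by `f'` times the primitive of `f`. -/
lemma exists_sq_le_deriv_mul_primitive (hC2 : C2On01 f f' f'')
    (hf0 : ∀ t ∈ Ico (0:ℝ) 1, 0 ≤ f t)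
    (hf'0 : ∀ t ∈ Ico (0:ℝ) 1, 0 ≤ f' t) (hγ : 0 < γ) (ht₀ : t₀ ∈ Ico (0 : ℝ) 1)
    (hCR : ∀ t ∈ Ico t₀ 1, 0 < f' t ∧ γ * f' t ^ 2 ≤ f t * f'' t) :
    ∃ C, 0 < C ∧ ∀ t ∈ Ico (0 : ℝ) 1,
      f t ^ 2 ≤ C * (f' t + 1) * ((∫ s in (0 : ℝ)..t, f s) + 1) := by
  have hCR' := mul_deriv_sq_le_succ_mul hf0 hγ ht₀.1 hCR
  have hsub : ∀ {t}, t ∈ Ico t₀ 1 → t ∈ Ico (0 : ℝ) 1 := fun ht => ⟨ht₀.1.trans ht.1, ht.2⟩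
  have hm : t₀ ∈ Ico t₀ 1 := ⟨le_rfl, ht₀.2⟩
  have hF0 : ∀ t ∈ Ico (0 : ℝ) 1, 0 ≤ ∫ s in (0 : ℝ)..t, f s := fun t ht =>
    intervalIntegral.integral_nonneg ht.1 fun s hs => hf0 s ⟨hs.1, hs.2.trans_lt ht.2⟩
  have hmono : MonotoneOn (fun t => 2 * (∫ s in (0 : ℝ)..t, f s) - f t ^ 2 / f' t)
      (Ico t₀ 1) := by
    refine monotoneOn_Ico_of_hasDerivWithinAt ht₀.1
      (fun t ht => ((hasDerivWithinAt_integral_Ico hC2.continuousOn (hsub ht)).const_mul 2).sub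
        (((hC2.1 t (hsub ht)).pow 2).div (hC2.2.1 t (hsub ht)) (hCR t ht).1.ne'))
      fun t ht => ?_
    have h1 := (hCR t ht).1
    have h2 : 0 ≤ f t ^ 2 * f'' t / f' t ^ 2 :=
      div_nonneg (mul_nonneg (sq_nonneg _) (hCR' t ht).1) (sq_nonneg _)
    convert h2 using 1
    field_simp
    simp
  have hd0 : 0 ≤ f t₀ ^ 2 / f' t₀ := div_nonneg (sq_nonneg _) (hCR t₀ hm).1.le
  refine ⟨2 + f t₀ ^ 2 / f' t₀ + f t₀ ^ 2, by positivity, fun t ht => ?_⟩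
  have hFt := hF0 t ht
  have hf't := hf'0 t ht
  set G := ∫ s in (0 : ℝ)..t, f s
  have hsq := sq_nonneg (f t₀)
  rcases le_or_gt t₀ t with h | h
  · have h1 := hmono hm ⟨h, ht.2⟩ h
    have h2 := (hCR t ⟨h, ht.2⟩).1
    have h3 := hF0 t₀ ht₀
    have h4 : f t ^ 2 / f' t ≤ 2 * G + f t₀ ^ 2 / f' t₀ := by simp only [] at h1; linarith
    rw [div_le_iff₀ h2] at h4
    refine h4.trans ?_
    rw [mul_comm (2 + _ + _), mul_assoc, mul_comm]
    refine mul_le_mul (by linarith) ?_ (by positivity) (by positivity)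
    nlinarith
  · have h1 : f t ^ 2 ≤ f t₀ ^ 2 :=
      pow_le_pow_left₀ (hf0 t ht) (monotoneOn_of_C2On01 hC2 hf'0 ht ht₀ h.le) 2
    refine h1.trans ?_
    have h5 : 1 ≤ (f' t + 1) * (G + 1) := by nlinarith
    rw [mul_assoc]
    nlinarith

/-- The functions entering the energy estimate obtained from the test function `(f(u)+1)^a η`. -/
lemma exists_testing_primitives (hC2 : C2On01 f f' f'') (hf0 : ∀ t ∈ Ico (0:ℝ) 1, 0 ≤ f t)
    (hf'0 : ∀ t ∈ Ico (0:ℝ) 1, 0 ≤ f' t) (hγ : 0 < γ) (ht₀ : t₀ ∈ Ico (0 : ℝ) 1)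
    (hCR : ∀ t ∈ Ico t₀ 1, 0 < f' t ∧ γ * f' t ^ 2 ≤ f t * f'' t) {a : ℝ} (ha : 1 < a)
    (haγ : (a - 1) ^ 2 < γ) :
    ∃ (ψ Ψ : ℝ → ℝ) (κ C : ℝ), κ < 1 ∧ 0 < C ∧
      ∀ t ∈ Ico (0 : ℝ) 1,
        HasDerivWithinAt ψ ((a * (f t + 1) ^ (a - 1) * f' t) ^ 2) (Ico 0 1) t ∧
        HasDerivWithinAt Ψ ((f t + 1) ^ a * (a * (f t + 1) ^ (a - 1) * f' t) - ψ t) (Ico 0 1) t ∧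
        0 ≤ ψ t ∧ ψ t * f t ≤ κ * (f' t * (f t + 1) ^ (2 * a)) + C * (f t + 1) ^ (2 * a) ∧
        |Ψ t| ≤ C * (f t + 1) ^ (2 * a) := by
  have hCR' := mul_deriv_sq_le_succ_mul hf0 hγ ht₀.1 hCR
  have hsub : ∀ {t}, t ∈ Ico t₀ 1 → t ∈ Ico (0 : ℝ) 1 := fun ht => ⟨ht₀.1.trans ht.1, ht.2⟩
  have hm : t₀ ∈ Ico t₀ 1 := ⟨le_rfl, ht₀.2⟩
  have hz : (0 : ℝ) ∈ Ico (0 : ℝ) 1 := ⟨le_rfl, one_pos⟩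
  have hpos : ∀ {t}, t ∈ Ico (0 : ℝ) 1 → 0 < f t + 1 := fun ht => by linarith [hf0 _ ht]
  have hφ' : ContinuousOn (fun t => a * (f t + 1) ^ (a - 1) * f' t) (Ico 0 1) :=
    (continuousOn_const.mul (hC2.continuousOn_rpow hf0 _)).mul hC2.continuousOn_deriv
  set ψ : ℝ → ℝ := fun t => ∫ s in (0 : ℝ)..t, (a * (f s + 1) ^ (a - 1) * f' s) ^ 2 with hψ
  have hψd : ∀ t ∈ Ico (0 : ℝ) 1,
      HasDerivWithinAt ψ ((a * (f t + 1) ^ (a - 1) * f' t) ^ 2) (Ico 0 1) t :=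
    fun t ht => hasDerivWithinAt_integral_Ico (hφ'.pow 2) ht
  have hψc : ContinuousOn ψ (Ico 0 1) := fun t ht => (hψd t ht).continuousWithinAt
  have hψmono : MonotoneOn ψ (Ico 0 1) :=
    monotoneOn_Ico_of_hasDerivWithinAt le_rfl hψd fun t _ => sq_nonneg _
  have hψ0 : ∀ t ∈ Ico (0 : ℝ) 1, 0 ≤ ψ t := fun t ht => by
    have h := hψmono hz ht ht.1
    have : ψ 0 = 0 := by simp [hψ]
    linarith
  set Ψ : ℝ → ℝ := fun t =>
    ∫ s in (0 : ℝ)..t, ((f s + 1) ^ a * (a * (f s + 1) ^ (a - 1) * f' s) - ψ s) with hΨ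
  have hΨd : ∀ t ∈ Ico (0 : ℝ) 1, HasDerivWithinAt Ψ
      ((f t + 1) ^ a * (a * (f t + 1) ^ (a - 1) * f' t) - ψ t) (Ico 0 1) t := fun t ht =>
    hasDerivWithinAt_integral_Ico (((hC2.continuousOn_rpow hf0 _).mul hφ').sub hψc) ht
  have hden : 0 < 2 * a - 1 + γ := by nlinarith
  set κ := a ^ 2 / (2 * a - 1 + γ) with hκ
  have hκ0 : 0 < κ := by positivity
  have hκ1 : κ < 1 := by rw [hκ, div_lt_one hden]; nlinarith
  have esq : ∀ {t}, t ∈ Ico (0 : ℝ) 1 → (f t + 1) ^ (2 * a - 2) = ((f t + 1) ^ (a - 1)) ^ 2 :=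
    fun ht => by rw [← Real.rpow_mul_natCast (hpos ht).le]; congr 1; push_cast; ring
  have e1 : ∀ {t}, t ∈ Ico (0 : ℝ) 1 →
      (f t + 1) ^ (2 * a - 1) = (f t + 1) ^ (2 * a - 2) * (f t + 1) :=
    fun ht => by rw [← Real.rpow_add_one (hpos ht).ne']; ring_nf
  have e2 : ∀ {t}, t ∈ Ico (0 : ℝ) 1 →
      (f t + 1) ^ (2 * a) = (f t + 1) ^ (2 * a - 1) * (f t + 1) :=
    fun ht => by rw [← Real.rpow_add_one (hpos ht).ne']; ring_nf
  have e3 : ∀ {t}, t ∈ Ico (0 : ℝ) 1 →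
      (f t + 1) ^ a * (f t + 1) ^ (a - 1) = (f t + 1) ^ (2 * a - 1) :=
    fun ht => by rw [← Real.rpow_add (hpos ht)]; ring_nf
  have hψle : ∀ t ∈ Ico (0 : ℝ) 1, ψ t ≤ κ * ((f t + 1) ^ (2 * a - 1) * f' t) + ψ t₀ := by
    have hmono : MonotoneOn (fun t => κ * ((f t + 1) ^ (2 * a - 1) * f' t) - ψ t)
        (Ico t₀ 1) := by
      refine monotoneOn_Ico_of_hasDerivWithinAt ht₀.1
        (fun t ht => (((hC2.hasDerivWithinAt_rpow hf0 (2 * a - 1) (hsub ht)).mul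
          (hC2.2.1 t (hsub ht))).const_mul κ).sub (hψd t (hsub ht))) fun t ht => ?_
      have hp : 0 < (f t + 1) ^ (2 * a - 2) := Real.rpow_pos_of_pos (hpos (hsub ht)) _
      have h1 : 0 ≤ κ * (f t + 1) ^ (2 * a - 2) * ((f t + 1) * f'' t - γ * f' t ^ 2) :=
        mul_nonneg (by positivity) (sub_nonneg.2 (hCR' t ht).2)
      have h2 : κ * (2 * a - 1 + γ) = a ^ 2 := div_mul_cancel₀ _ hden.ne'
      rw [e1 (hsub ht), show 2 * a - 1 - 1 = 2 * a - 2 by ring, mul_pow, mul_pow,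
        ← esq (hsub ht), ← h2]
      linarith
    intro t ht
    have hr : ∀ {t}, t ∈ Ico (0 : ℝ) 1 → 0 ≤ κ * ((f t + 1) ^ (2 * a - 1) * f' t) := fun ht =>
      mul_nonneg hκ0.le (mul_nonneg (Real.rpow_nonneg (hpos ht).le _) (hf'0 _ ht))
    rcases le_or_gt t₀ t with h | h
    · have h1 := hmono hm ⟨h, ht.2⟩ h
      simp only [] at h1
      linarith [hr ht₀]
    · linarith [hψmono ht ht₀ h.le, hr ht]
  have hp1 : ∀ t ∈ Ico (0 : ℝ) 1, 1 ≤ (f t + 1) ^ (2 * a - 1) := fun t ht =>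
    Real.one_le_rpow (by linarith [hf0 t ht]) (by linarith)
  have hp2 : ∀ t ∈ Ico (0 : ℝ) 1, 1 ≤ (f t + 1) ^ (2 * a) := fun t ht =>
    Real.one_le_rpow (by linarith [hf0 t ht]) (by linarith)
  have hΨle : ∀ σ : ℝ, |σ| = 1 → ∀ t ∈ Ico (0 : ℝ) 1,
      σ * Ψ t ≤ (a + 1) * (f t + 1) ^ (2 * a) + ψ t₀ * t := by
    intro σ hσ t ht
    have hmono : MonotoneOn
        (fun t => (a + 1) * (f t + 1) ^ (2 * a) + ψ t₀ * t - σ * Ψ t) (Ico 0 1) := by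
      refine monotoneOn_Ico_of_hasDerivWithinAt le_rfl
        (fun t ht => (((hC2.hasDerivWithinAt_rpow hf0 (2 * a) ht).const_mul (a + 1)).add
          ((hasDerivWithinAt_id t _).const_mul (ψ t₀))).sub ((hΨd t ht).const_mul σ))
        fun t ht => ?_
      have h1 := hψle t ht
      have h2 := hψ0 t ht
      have hX : 0 ≤ (f t + 1) ^ (2 * a - 1) * f' t :=
        mul_nonneg (Real.rpow_nonneg (hpos ht).le _) (hf'0 _ ht)
      have h4 : (f t + 1) ^ a * (a * (f t + 1) ^ (a - 1) * f' t) =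
          a * ((f t + 1) ^ (2 * a - 1) * f' t) := by rw [← e3 ht]; ring
      rw [h4]
      set X := (f t + 1) ^ (2 * a - 1) * f' t
      have h5 : σ * (a * X - ψ t) ≤ a * X + ψ t := by
        refine (le_abs_self _).trans ?_
        rw [abs_mul, hσ, one_mul, abs_le]
        constructor <;> nlinarith
      have h6 : (a + 1) * (2 * a * (f t + 1) ^ (2 * a - 1) * f' t) = 2 * a * (a + 1) * X := by
        simp only [X]; ring
      rw [h6]
      nlinarith
    have h1 := hmono hz ht ht.1
    have h2 : Ψ 0 = 0 := by simp [hΨ]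
    simp only [h2] at h1
    nlinarith [hp2 0 hz]
  refine ⟨ψ, Ψ, κ, a + 1 + ψ t₀, hκ1, by linarith [hψ0 t₀ ht₀], fun t ht =>
    ⟨hψd t ht, hΨd t ht, hψ0 t ht, ?_, ?_⟩⟩
  · have h1 := hψle t ht
    have h2 := hp1 t ht
    have h3 := hf0 t ht
    have hc := hψ0 t₀ ht₀
    have h4 : ψ t * f t ≤ ψ t * (f t + 1) := by nlinarith [hψ0 t ht]
    have h5 : ψ t * (f t + 1) ≤ (κ * ((f t + 1) ^ (2 * a - 1) * f' t) + ψ t₀) * (f t + 1) :=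
      mul_le_mul_of_nonneg_right h1 (hpos ht).le
    have h6 : ψ t₀ * (f t + 1) ≤ (a + 1 + ψ t₀) * (f t + 1) ^ (2 * a) := by
      refine mul_le_mul (by linarith) ?_ (hpos ht).le (by linarith)
      rw [e2 ht]
      nlinarith [hpos ht]
    rw [e2 ht] at h6 ⊢
    linarith
  · have h1 := hΨle 1 (by simp) t ht
    have h2 := hΨle (-1) (by simp) t ht
    have h3 : ψ t₀ * t ≤ ψ t₀ * (f t + 1) ^ (2 * a) :=
      mul_le_mul_of_nonneg_left (ht.2.le.trans (hp2 t ht)) (hψ0 t₀ ht₀)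
    rw [abs_le]
    constructor <;> linarith

end Threshold

lemma contDiff_mul_of_tsupport_subset {n : ℕ} {Ω : Set (EuclideanSpace ℝ (Fin n))}
    (hΩ : IsOpen Ω) {a b : EuclideanSpace ℝ (Fin n) → ℝ} (ha : ContDiffOn ℝ 1 a Ω)
    (hb : ContDiff ℝ 1 b) (hs : tsupport b ⊆ Ω) : ContDiff ℝ 1 (fun x => a x * b x) := by
  rw [contDiff_iff_contDiffAt]
  intro x
  by_cases hx : x ∈ Ω
  · exact (ha.contDiffAt (hΩ.mem_nhds hx)).mul hb.contDiffAt
  · have h0 : (fun x => a x * b x) =ᶠ[𝓝 x] fun _ => 0 := by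
      filter_upwards [(isClosed_tsupport b).isOpen_compl.mem_nhds fun h => hx (hs h)] with y hy
      simp [image_eq_zero_of_notMem_tsupport hy]
    exact contDiffAt_const.congr_of_eventuallyEq h0

lemma partialDeriv_pow_succ {n : ℕ} {b : EuclideanSpace ℝ (Fin n) → ℝ}
    (hb : Differentiable ℝ b) (k : ℕ) (i : Fin n) :
    partialDeriv i (fun y => b y ^ (k + 1)) =
      fun x => ((k : ℝ) + 1) * (b x ^ k * partialDeriv i b x) := by
  ext x
  simp only [partialDeriv]
  rw [fderiv_fun_pow (k + 1) (hb x)]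
  simp
  ring

/-- Cutoff functions between `B_{7/8}` and `B_{15/16}` whose powers have controlled derivatives. -/
lemma exists_cutoff (n k : ℕ) :
    ∃ (ζ : EuclideanSpace ℝ (Fin n) → ℝ) (M : ℝ), ContDiff ℝ (⊤ : ℕ∞) ζ ∧
      (∀ x, 0 ≤ ζ x ∧ ζ x ≤ 1) ∧ (∀ x ∈ closedBall 0 (7 / 8), ζ x = 1) ∧
      tsupport ζ = closedBall 0 (15 / 16) ∧ 0 ≤ M ∧
      ∀ x, ∑ i, partialDeriv i (fun y => ζ y ^ (k + 1)) x ^ 2 ≤ M * ζ x ^ (2 * k) ∧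
        |∑ i, partialDeriv i (partialDeriv i (fun y => ζ y ^ (2 * k + 1 + 1))) x| ≤
          M * ζ x ^ (2 * k) := by
  let φ : ContDiffBump (0 : EuclideanSpace ℝ (Fin n)) := ⟨7 / 8, 15 / 16, by norm_num, by norm_num⟩
  have hφ : ContDiff ℝ (⊤ : ℕ∞) φ := φ.contDiff
  have hs : tsupport φ = closedBall 0 (15 / 16) := φ.tsupport_eq
  have hd : Differentiable ℝ φ := hφ.differentiable (by simp)
  have h1 : ∀ i, ContDiff ℝ 1 (partialDeriv i φ) := fun i =>
    ContDiff.partialDeriv (contDiff_infty.1 hφ 2) (by norm_num) i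
  have h2 : ∀ i, Continuous (partialDeriv i (partialDeriv i φ)) := fun i =>
    (ContDiff.partialDeriv (h1 i) (m := 0) (by norm_num) i).continuous
  have hK := isCompact_closedBall (0 : EuclideanSpace ℝ (Fin n)) (15 / 16)
  obtain ⟨A, hA⟩ := hK.exists_bound_of_continuousOn (f := fun x => ∑ i, partialDeriv i φ x ^ 2)
    (continuous_finsetSum _ fun i _ => (h1 i).continuous.pow 2).continuousOn
  obtain ⟨B, hB⟩ := hK.exists_bound_of_continuousOn
    (f := fun x => ∑ i, partialDeriv i (partialDeriv i φ) x)
    (continuous_finsetSum _ fun i _ => h2 i).continuousOn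
  have hA' : ∀ x, ∑ i, partialDeriv i φ x ^ 2 ≤ max A 0 := fun x => by
    by_cases hx : x ∈ closedBall 0 (15 / 16)
    · exact ((le_abs_self _).trans (hA x hx)).trans (le_max_left _ _)
    · rw [← hs] at hx
      simp [partialDeriv_eq_zero_of_notMem_tsupport _ hx]
  have hB' : ∀ x, |∑ i, partialDeriv i (partialDeriv i φ) x| ≤ max B 0 := fun x => by
    by_cases hx : x ∈ closedBall 0 (15 / 16)
    · exact (hB x hx).trans (le_max_left _ _)
    · rw [← hs] at hx
      simp [partialDeriv_eq_zero_of_notMem_tsupport _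
        fun h => hx (tsupport_partialDeriv_subset _ _ h)]
  have hA0 : 0 ≤ max A 0 := le_max_right _ _
  have hB0 : 0 ≤ max B 0 := le_max_right _ _
  set A' := max A 0
  set B' := max B 0
  have hk : (0 : ℝ) ≤ k := Nat.cast_nonneg k
  refine ⟨φ, ((k : ℝ) + 1) ^ 2 * A' + (2 * k + 2) * (2 * k + 1) * A' + (2 * k + 2) * B', hφ,
    fun x => ⟨φ.nonneg, φ.le_one⟩, fun x hx => φ.one_of_mem_closedBall hx, hs, by positivity,
    fun x => ⟨?_, ?_⟩⟩
  · have hz : 0 ≤ φ x ^ (2 * k) := pow_nonneg φ.nonneg _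
    have e : ∑ i, partialDeriv i (fun y => φ y ^ (k + 1)) x ^ 2 =
        (((k : ℝ) + 1) ^ 2 * ∑ i, partialDeriv i φ x ^ 2) * φ x ^ (2 * k) := by
      rw [Finset.mul_sum, Finset.sum_mul]
      refine Finset.sum_congr rfl fun i _ => ?_
      rw [partialDeriv_pow_succ hd]
      ring
    rw [e]
    refine mul_le_mul_of_nonneg_right ?_ hz
    have := mul_le_mul_of_nonneg_left (hA' x) (sq_nonneg ((k : ℝ) + 1))
    have : 0 ≤ (2 * (k : ℝ) + 2) * (2 * k + 1) * A' := by positivity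
    have : 0 ≤ (2 * (k : ℝ) + 2) * B' := by positivity
    linarith
  · have hz : 0 ≤ φ x ^ (2 * k) := pow_nonneg φ.nonneg _
    have e : ∑ i, partialDeriv i (partialDeriv i (fun y => φ y ^ (2 * k + 1 + 1))) x =
        ((2 * k + 2) * (2 * k + 1) * (∑ i, partialDeriv i φ x ^ 2) +
          (2 * k + 2) * (φ x * ∑ i, partialDeriv i (partialDeriv i φ) x)) * φ x ^ (2 * k) := by
      rw [Finset.mul_sum, Finset.mul_sum, Finset.mul_sum, ← Finset.sum_add_distrib, Finset.sum_mul]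
      refine Finset.sum_congr rfl fun i _ => ?_
      have h3 : DifferentiableAt ℝ (partialDeriv i φ) x := (h1 i).differentiable one_ne_zero x
      have h4 : DifferentiableAt ℝ (fun y => φ y ^ (2 * k + 1)) x := (hd x).pow _
      have h5 : partialDeriv i (fun y => φ y ^ (2 * k + 1 + 1)) = fun y =>
          ((2 * k + 2 : ℝ) * φ y ^ (2 * k + 1)) * partialDeriv i φ y := by
        rw [partialDeriv_pow_succ hd]; ext y; push_cast; ring
      have h6 : partialDeriv i (fun y => (2 * k + 2 : ℝ) * φ y ^ (2 * k + 1)) x =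
          (2 * k + 2) * ((2 * k + 1) * (φ x ^ (2 * k) * partialDeriv i φ x)) := by
        rw [partialDeriv_mul (differentiableAt_const _) h4, partialDeriv_pow_succ hd]
        simp [partialDeriv]
      rw [h5, partialDeriv_mul (h4.const_mul _) h3, h6]
      ring
    rw [e, abs_mul, abs_of_nonneg hz]
    refine mul_le_mul_of_nonneg_right ?_ hz
    have a1 : |φ x * ∑ i, partialDeriv i (partialDeriv i φ) x| ≤ B' := by
      rw [abs_mul, abs_of_nonneg φ.nonneg]
      exact (mul_le_mul φ.le_one (hB' x) (abs_nonneg _) zero_le_one).trans (one_mul _).le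
    have a2 : 0 ≤ ∑ i, partialDeriv i φ x ^ 2 := Finset.sum_nonneg fun i _ => sq_nonneg _
    refine (abs_add_le _ _).trans ?_
    rw [abs_mul, abs_mul _ (φ x * _), abs_of_nonneg a2,
      abs_of_nonneg (by positivity : (0 : ℝ) ≤ (2 * k + 2) * (2 * k + 1)),
      abs_of_nonneg (by positivity : (0 : ℝ) ≤ 2 * k + 2)]
    have := mul_le_mul_of_nonneg_left (hA' x)
      (by positivity : (0 : ℝ) ≤ (2 * k + 2) * (2 * k + 1))
    have := mul_le_mul_of_nonneg_left a1 (by positivity : (0 : ℝ) ≤ 2 * k + 2)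
    have : 0 ≤ ((k : ℝ) + 1) ^ 2 * A' := by positivity
    linarith

lemma rpow_mul_pow_le_young {h γ b ζ ε : ℝ} {k : ℕ} (hh : 1 ≤ h) (hε : 0 < ε)
    (hk : b ≤ γ * k) :
    h ^ b * ζ ^ (2 * k) ≤ ε * (h ^ γ * (h ^ b * ζ ^ (2 * k + 1 + 1))) + (ε⁻¹) ^ k := by
  have h0 : 0 < h := one_pos.trans_le hh
  have hb : 0 < h ^ b := Real.rpow_pos_of_pos h0 _
  have hg : 0 < h ^ γ := Real.rpow_pos_of_pos h0 _
  have hz : 0 ≤ ζ ^ (2 * k) := by rw [pow_mul]; positivity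
  rcases le_total 1 (ε * h ^ γ * ζ ^ 2) with hc | hc
  · have h1 : h ^ b * ζ ^ (2 * k) ≤ (ε * h ^ γ * ζ ^ 2) * (h ^ b * ζ ^ (2 * k)) :=
      le_mul_of_one_le_left (by positivity) hc
    have h2 : 0 ≤ (ε⁻¹) ^ k := by positivity
    have h3 : ζ ^ (2 * k + 1 + 1) = ζ ^ (2 * k) * ζ ^ 2 := by ring
    rw [h3]
    linarith
  · have h1 : ζ ^ 2 ≤ ε⁻¹ * (h ^ γ)⁻¹ := by
      rw [← mul_inv, ← one_div, le_div_iff₀ (by positivity)]; linarith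
    have h2 : ζ ^ (2 * k) ≤ (ε⁻¹) ^ k * (h ^ (γ * k))⁻¹ := by
      rw [pow_mul, Real.rpow_mul_natCast h0.le, ← inv_pow, ← mul_pow]
      exact pow_le_pow_left₀ (sq_nonneg _) h1 k
    have h3 : h ^ b * (h ^ (γ * k))⁻¹ ≤ 1 := by
      rw [← div_eq_mul_inv, div_le_one (Real.rpow_pos_of_pos h0 _)]
      exact Real.rpow_le_rpow_of_exponent_le hh hk
    have h4 : h ^ b * ζ ^ (2 * k) ≤ (ε⁻¹) ^ k * (h ^ b * (h ^ (γ * k))⁻¹) := by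
      have := mul_le_mul_of_nonneg_left h2 hb.le
      linarith
    have h5 : (ε⁻¹) ^ k * (h ^ b * (h ^ (γ * k))⁻¹) ≤ (ε⁻¹) ^ k * 1 :=
      mul_le_mul_of_nonneg_left h3 (by positivity)
    have h6 : 0 ≤ ε * (h ^ γ * (h ^ b * ζ ^ (2 * k + 1 + 1))) := by
      rw [show 2 * k + 1 + 1 = 2 * (k + 1) by ring, pow_mul]
      positivity
    linarith

/-- The stability inequality tested with `φ(u) η`, after integrating by parts twice. -/
lemma integral_nonneg_of_stable {n : ℕ} {f f' : ℝ → ℝ} {u : EuclideanSpace ℝ (Fin n) → ℝ}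
    {Ω : Set (EuclideanSpace ℝ (Fin n))} (hΩ : IsOpen Ω) (hu : ContDiffOn ℝ 2 u Ω)
    (hmaps : MapsTo u Ω (Ico 0 1)) (heq : ∀ x ∈ Ω, -lap u x = f (u x)) (hst : StableSol f' u Ω)
    (hf' : ContinuousOn f' (Ico 0 1)) {φ φ' ψ Ψ : ℝ → ℝ} (hφ' : ContinuousOn φ' (Ico 0 1))
    (hφ : ∀ t ∈ Ico (0 : ℝ) 1, HasDerivWithinAt φ (φ' t) (Ico 0 1) t)
    (hψ : ∀ t ∈ Ico (0 : ℝ) 1, HasDerivWithinAt ψ (φ' t ^ 2) (Ico 0 1) t)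
    (hΨ : ∀ t ∈ Ico (0 : ℝ) 1, HasDerivWithinAt Ψ (φ t * φ' t - ψ t) (Ico 0 1) t)
    {η ρ : EuclideanSpace ℝ (Fin n) → ℝ} (hη : ContDiff ℝ 1 η) (hρ : ContDiff ℝ 2 ρ)
    (hρη : ∀ x, ρ x = η x * η x) (hc : HasCompactSupport η) (hs : tsupport η ⊆ Ω) :
    Integrable (fun x => φ (u x) ^ 2 * ∑ i, partialDeriv i η x ^ 2 + ψ (u x) * f (u x) * ρ x
      - Ψ (u x) * ∑ i, partialDeriv i (partialDeriv i ρ) x - f' (u x) * φ (u x) ^ 2 * ρ x) ∧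
    0 ≤ ∫ x, (φ (u x) ^ 2 * ∑ i, partialDeriv i η x ^ 2 + ψ (u x) * f (u x) * ρ x
      - Ψ (u x) * ∑ i, partialDeriv i (partialDeriv i ρ) x - f' (u x) * φ (u x) ^ 2 * ρ x) := by
  have hu1 : ContDiffOn ℝ 1 u Ω := hu.of_le (by norm_num)
  have hφc : ContinuousOn φ (Ico 0 1) := fun t ht => (hφ t ht).continuousWithinAt
  have hψc : ContinuousOn ψ (Ico 0 1) := fun t ht => (hψ t ht).continuousWithinAt
  obtain ⟨cφ, dφ⟩ := contDiffOn_comp_Ico hΩ hu1 hmaps hφ hφ'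
  obtain ⟨cψ, dψ⟩ := contDiffOn_comp_Ico hΩ hu1 hmaps hψ (hφ'.pow 2)
  obtain ⟨cΨ, dΨ⟩ := contDiffOn_comp_Ico hΩ hu1 hmaps hΨ ((hφc.mul hφ').sub hψc)
  have hρ1 : ContDiff ℝ 1 ρ := hρ.of_le (by norm_num)
  have hρs : tsupport ρ ⊆ tsupport η := by
    refine closure_mono fun x hx hx' => hx ?_
    simp [hρη, hx']
  have hρc : HasCompactSupport ρ := hc.of_isClosed_subset (isClosed_tsupport _) hρs
  have hdu : ∀ i, ContDiffOn ℝ 1 (partialDeriv i u) Ω := fun i =>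
    ContDiffOn.partialDeriv hΩ hu (by norm_num) i
  have hdρ : ∀ i, ContDiff ℝ 1 (partialDeriv i ρ) := fun i =>
    ContDiff.partialDeriv hρ (by norm_num) i
  have b1 := fun i => integral_partialDeriv_mul_add hΩ
    (a := fun x => ψ (u x) * partialDeriv i u x) (cψ.mul (hdu i)) hρ1 hρc (hρs.trans hs) i
  have b2 := fun i => integral_partialDeriv_mul_add hΩ cΨ (hdρ i)
    (hρc.of_isClosed_subset (isClosed_tsupport _) (tsupport_partialDeriv_subset ρ i))
    (((tsupport_partialDeriv_subset ρ i).trans hρs).trans hs) i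
  set R : EuclideanSpace ℝ (Fin n) → ℝ := fun x => ∑ i,
    ((partialDeriv i (fun x => ψ (u x) * partialDeriv i u x) x * ρ x +
      ψ (u x) * partialDeriv i u x * partialDeriv i ρ x) +
    (partialDeriv i (fun x => Ψ (u x)) x * partialDeriv i ρ x +
      Ψ (u x) * partialDeriv i (partialDeriv i ρ) x)) with hR
  have hRi : Integrable R := integrable_finsetSum _ fun i _ =>
    ((b1 i).1.add (b1 i).2.1).add ((b2 i).1.add (b2 i).2.1)
  have hR0 : ∫ x, R x = 0 := by
    refine (integral_finsetSum _ fun i _ =>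
      ((b1 i).1.add (b1 i).2.1).add ((b2 i).1.add (b2 i).2.1)).trans ?_
    refine Finset.sum_eq_zero fun i _ => ?_
    have k1 := integral_add (b1 i).1 (b1 i).2.1
    have k2 := integral_add (b2 i).1 (b2 i).2.1
    have k3 := integral_add ((b1 i).1.add (b1 i).2.1) ((b2 i).1.add (b2 i).2.1)
    refine k3.trans ?_
    simp only [Pi.add_apply]
    rw [k1, k2, (b1 i).2.2, (b2 i).2.2]
    ring
  set ξ : EuclideanSpace ℝ (Fin n) → ℝ := fun x => φ (u x) * η x with hξdef
  have hξ : ContDiff ℝ 1 ξ := contDiff_mul_of_tsupport_subset hΩ cφ hη hs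
  have hξs : tsupport ξ ⊆ tsupport η := by
    refine closure_mono fun x hx hx' => hx ?_
    simp [hξdef, hx']
  have hξc : HasCompactSupport ξ := hc.of_isClosed_subset (isClosed_tsupport _) hξs
  have hf'u : ContinuousOn (fun x => f' (u x)) Ω := hf'.comp hu1.continuousOn hmaps
  have hS := hst.nonneg_of_contDiff_one hΩ hf'u hξ hξc (hξs.trans hs)
  have hSi : Integrable (fun x => ∑ i, partialDeriv i ξ x ^ 2 - f' (u x) * ξ x ^ 2) := by
    refine integrable_of_continuousOn_of_eq_zero (K := tsupport ξ) hξc ?_ fun x hx => ?_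
    · refine ContinuousOn.sub ?_ ((hf'u.mono (hξs.trans hs)).mul
        (hξ.continuous.pow 2).continuousOn)
      refine continuousOn_finsetSum _ fun i _ => ?_
      exact ((ContDiff.partialDeriv hξ (m := 0) (by norm_num) i).continuous.pow 2).continuousOn
    · simp [partialDeriv_eq_zero_of_notMem_tsupport _ hx, image_eq_zero_of_notMem_tsupport hx]
  have hQ : (fun x => φ (u x) ^ 2 * ∑ i, partialDeriv i η x ^ 2 + ψ (u x) * f (u x) * ρ x
      - Ψ (u x) * ∑ i, partialDeriv i (partialDeriv i ρ) x - f' (u x) * φ (u x) ^ 2 * ρ x) =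
      fun x => (∑ i, partialDeriv i ξ x ^ 2 - f' (u x) * ξ x ^ 2) - R x := by
    ext x
    by_cases hx : x ∈ tsupport η
    · have hxΩ := hs hx
      have hnx := hΩ.mem_nhds hxΩ
      have dη : DifferentiableAt ℝ η x := hη.differentiable one_ne_zero x
      have dψu := (cψ.differentiableOn one_ne_zero).differentiableAt hnx
      have dφu := (cφ.differentiableOn one_ne_zero).differentiableAt hnx
      have hdρx : ∀ i, partialDeriv i ρ x = 2 * η x * partialDeriv i η x := fun i => by
        rw [show ρ = fun y => η y * η y from funext hρη, partialDeriv_mul dη dη]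
        ring
      have hlap : f (u x) = - ∑ i, partialDeriv i (partialDeriv i u) x := (heq x hxΩ).symm
      have hdξ : ∀ i, partialDeriv i ξ x =
          φ' (u x) * partialDeriv i u x * η x + φ (u x) * partialDeriv i η x := fun i => by
        rw [hξdef, partialDeriv_mul dφu dη, dφ x hxΩ]
      have hdψ : ∀ i, partialDeriv i (fun x => ψ (u x) * partialDeriv i u x) x =
          φ' (u x) ^ 2 * partialDeriv i u x * partialDeriv i u x +
            ψ (u x) * partialDeriv i (partialDeriv i u) x := fun i => by
        rw [partialDeriv_mul dψu (((hdu i).differentiableOn one_ne_zero).differentiableAt hnx),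
          dψ x hxΩ]
      simp only [hR]
      have e : ∑ i, partialDeriv i ξ x ^ 2 - ∑ i,
          ((partialDeriv i (fun x => ψ (u x) * partialDeriv i u x) x * ρ x +
            ψ (u x) * partialDeriv i u x * partialDeriv i ρ x) +
          (partialDeriv i (fun x => Ψ (u x)) x * partialDeriv i ρ x +
            Ψ (u x) * partialDeriv i (partialDeriv i ρ) x)) =
          φ (u x) ^ 2 * ∑ i, partialDeriv i η x ^ 2
            - ψ (u x) * ρ x * ∑ i, partialDeriv i (partialDeriv i u) x
            - Ψ (u x) * ∑ i, partialDeriv i (partialDeriv i ρ) x := by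
        rw [Finset.mul_sum, Finset.mul_sum, Finset.mul_sum, ← Finset.sum_sub_distrib,
          ← Finset.sum_sub_distrib, ← Finset.sum_sub_distrib]
        refine Finset.sum_congr rfl fun i _ => ?_
        rw [hdψ, dΨ x hxΩ, hdξ, hdρx, hρη]
        ring
      have e2 : ξ x ^ 2 = φ (u x) ^ 2 * ρ x := by rw [hρη]; simp only [hξdef]; ring
      rw [e2, hlap]
      linear_combination -e
    · have hxρ : x ∉ tsupport ρ := fun h => hx (hρs h)
      have hxξ : x ∉ tsupport ξ := fun h => hx (hξs h)
      have hxρ' : ∀ i, x ∉ tsupport (partialDeriv i ρ) := fun i h =>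
        hxρ (tsupport_partialDeriv_subset ρ i h)
      simp [hR, partialDeriv_eq_zero_of_notMem_tsupport _ hx,
        partialDeriv_eq_zero_of_notMem_tsupport _ hxρ, partialDeriv_eq_zero_of_notMem_tsupport _ hxξ,
        partialDeriv_eq_zero_of_notMem_tsupport _ (hxρ' _), image_eq_zero_of_notMem_tsupport hxρ,
        image_eq_zero_of_notMem_tsupport hxξ]
  rw [hQ]
  refine ⟨hSi.sub hRi, ?_⟩
  rw [integral_sub hSi hRi, hR0, sub_zero]
  exact hS

/-- Weighted energy estimate for stable solutions, uniform in the solution. -/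
lemma exists_energy_bound (n : ℕ) {f f' f'' : ℝ → ℝ} {γ t₀ a : ℝ} (hC2 : C2On01 f f' f'')
    (hf0 : ∀ t ∈ Ico (0:ℝ) 1, 0 ≤ f t) (hf'0 : ∀ t ∈ Ico (0:ℝ) 1, 0 ≤ f' t) (hγ : 0 < γ)
    (ht₀ : t₀ ∈ Ico (0 : ℝ) 1) (hCR : ∀ t ∈ Ico t₀ 1, 0 < f' t ∧ γ * f' t ^ 2 ≤ f t * f'' t)
    (ha : 1 < a) (haγ : (a - 1) ^ 2 < γ) :
    ∃ C, ∀ u : EuclideanSpace ℝ (Fin n) → ℝ, ContDiffOn ℝ 2 u (ball 0 1) →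
      MapsTo u (ball 0 1) (Ico 0 1) → (∀ x ∈ ball 0 1, -lap u x = f (u x)) →
      StableSol f' u (ball 0 1) →
      ∫ x in closedBall 0 (7 / 8), (f' (u x) + 1) * (f (u x) + 1) ^ (2 * a) ≤ C := by
  obtain ⟨ψ, Ψ, κ, C, hκ, hC, hprim⟩ := exists_testing_primitives hC2 hf0 hf'0 hγ ht₀ hCR ha haγ
  obtain ⟨C₂, hC₂, hpow⟩ := exists_rpow_le_deriv hC2 hf0 hf'0 hγ ht₀ hCR
  obtain ⟨k, hk⟩ : ∃ k : ℕ, 2 * a ≤ γ * k := by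
    obtain ⟨k, hk⟩ := exists_nat_ge (2 * a / γ)
    exact ⟨k, by rwa [div_le_iff₀' hγ] at hk⟩
  obtain ⟨ζ, M, hζ, hζ01, hζ1, hζs, hM, hζd⟩ := exists_cutoff n k
  set A := M + C * M + C with hA
  have hA0 : 0 ≤ A := by positivity
  obtain ⟨s, hs0, hs1, hs2⟩ : ∃ s : ℝ, 0 < s ∧ s ≤ 1 / 2 ∧ (A + 1) * (2 * s) ≤ (1 - κ) / 2 := by
    refine ⟨min (1 / 2) ((1 - κ) / (4 * (A + 1))), ?_, min_le_left _ _, ?_⟩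
    · have : 0 < 1 - κ := by linarith
      positivity
    · have := min_le_right (1 / 2) ((1 - κ) / (4 * (A + 1)))
      rw [le_div_iff₀ (by positivity)] at this
      linarith
  set K := ((s / C₂)⁻¹) ^ k with hK
  set c := min ((1 - κ) / 2) 1 with hc
  have hc0 : 0 < c := lt_min (by linarith) one_pos
  refine ⟨c⁻¹ * (2 * (A + 1) * K * volume.real (closedBall (0 : EuclideanSpace ℝ (Fin n)) (15 / 16))),
    fun u hu hmaps heq hst => ?_⟩
  have hsub : closedBall (0 : EuclideanSpace ℝ (Fin n)) (15 / 16) ⊆ ball 0 1 :=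
    closedBall_subset_ball (by norm_num)
  have hη : ContDiff ℝ (⊤ : ℕ∞) (fun x => ζ x ^ (k + 1)) := hζ.pow _
  have hρ : ContDiff ℝ (⊤ : ℕ∞) (fun x => ζ x ^ (2 * k + 1 + 1)) := hζ.pow _
  have hηs : tsupport (fun x => ζ x ^ (k + 1)) ⊆ tsupport ζ := by
    refine closure_mono fun x hx hx' => hx ?_
    simp [hx']
  have hcpt : IsCompact (closedBall (0 : EuclideanSpace ℝ (Fin n)) (15 / 16)) :=
    isCompact_closedBall _ _
  have hηc : HasCompactSupport (fun x => ζ x ^ (k + 1)) :=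
    hcpt.of_isClosed_subset (isClosed_tsupport _) (hηs.trans hζs.subset)
  have hXc : ContinuousOn (fun t => (f t + 1) ^ (2 * a)) (Ico 0 1) := hC2.continuousOn_rpow hf0 _
  obtain ⟨hQi, hQ⟩ := integral_nonneg_of_stable isOpen_ball hu hmaps heq hst
    hC2.continuousOn_deriv (φ := fun t => (f t + 1) ^ a)
    (φ' := fun t => a * (f t + 1) ^ (a - 1) * f' t) (ψ := ψ) (Ψ := Ψ)
    ((continuousOn_const.mul (hC2.continuousOn_rpow hf0 _)).mul hC2.continuousOn_deriv)
    (fun t ht => hC2.hasDerivWithinAt_rpow hf0 a ht) (fun t ht => (hprim t ht).1)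
    (fun t ht => (hprim t ht).2.1) (contDiff_infty.1 hη 1)
    (contDiff_infty.1 hρ 2) (fun x => by ring) hηc
    ((hηs.trans hζs.subset).trans hsub)
  set Q : EuclideanSpace ℝ (Fin n) → ℝ := fun x => ((f (u x) + 1) ^ a) ^ 2 *
      ∑ i, partialDeriv i (fun x => ζ x ^ (k + 1)) x ^ 2 + ψ (u x) * f (u x) * ζ x ^ (2 * k + 1 + 1)
      - Ψ (u x) * ∑ i, partialDeriv i (partialDeriv i (fun x => ζ x ^ (2 * k + 1 + 1))) x
      - f' (u x) * ((f (u x) + 1) ^ a) ^ 2 * ζ x ^ (2 * k + 1 + 1) with hQdef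
  set W : EuclideanSpace ℝ (Fin n) → ℝ := fun x =>
    (1 - κ) / 2 * (f' (u x) * (f (u x) + 1) ^ (2 * a) * ζ x ^ (2 * k + 1 + 1)) +
      (f (u x) + 1) ^ (2 * a) * ζ x ^ (2 * k) with hWdef
  have hk0 : k ≠ 0 := by
    rintro rfl
    simp only [Nat.cast_zero, mul_zero] at hk
    linarith
  have hζ0 : ∀ x ∉ closedBall (0 : EuclideanSpace ℝ (Fin n)) (15 / 16), ζ x = 0 := fun x hx =>
    image_eq_zero_of_notMem_tsupport (hζs ▸ hx)
  have hmapsc : ∀ {g : ℝ → ℝ}, ContinuousOn g (Ico 0 1) →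
      ContinuousOn (fun x => g (u x)) (ball 0 1) := fun hg => hg.comp hu.continuousOn hmaps
  have hWi : Integrable W := by
    refine integrable_of_continuousOn_of_eq_zero hcpt (ContinuousOn.mono ?_ hsub) fun x hx => ?_
    · exact (continuousOn_const.mul (((hmapsc hC2.continuousOn_deriv).mul (hmapsc hXc)).mul
        hρ.continuous.continuousOn)).add ((hmapsc hXc).mul (hζ.continuous.pow _).continuousOn)
    · simp [hWdef, hζ0 x hx, hk0]
  have hsq : ∀ x ∈ ball (0 : EuclideanSpace ℝ (Fin n)) 1,
      ((f (u x) + 1) ^ a) ^ 2 = (f (u x) + 1) ^ (2 * a) := fun x hx => by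
    rw [← Real.rpow_natCast, ← Real.rpow_mul (by linarith [hf0 _ (hmaps hx)]), mul_comm]
    norm_num
  have hX0 : ∀ x ∈ ball (0 : EuclideanSpace ℝ (Fin n)) 1, 0 < (f (u x) + 1) ^ (2 * a) :=
    fun x hx => Real.rpow_pos_of_pos (by linarith [hf0 _ (hmaps hx)]) _
  have hW0 : ∀ x, 0 ≤ W x := fun x => by
    by_cases hx : x ∈ ball 0 1
    · have h1 := hX0 x hx
      have h2 := hf'0 _ (hmaps hx)
      have h3 := (hζ01 x).1
      have h4 : 0 < 1 - κ := by linarith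
      simp only [hWdef]
      positivity
    · simp [hWdef, hζ0 x fun h => hx (hsub h), hk0]
  have hpt : ∀ x ∈ closedBall (0 : EuclideanSpace ℝ (Fin n)) (15 / 16),
      W x + Q x ≤ 2 * (A + 1) * K := fun x hx => by
    have hx1 := hsub hx
    have hux := hmaps hx1
    have hX := hX0 x hx1
    have hζx := hζ01 x
    have hf1 := hf0 _ hux
    have hf2 := hf'0 _ hux
    obtain ⟨-, -, hψ0, hψ1, hΨ1⟩ := hprim _ hux
    obtain ⟨hd1, hd2⟩ := hζd x
    have hy := rpow_mul_pow_le_young (h := f (u x) + 1) (ζ := ζ x) (by linarith)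
      (div_pos hs0 hC₂) hk
    have hp := hpow _ hux
    simp only [hWdef, hQdef, hsq x hx1]
    set X := (f (u x) + 1) ^ (2 * a)
    have hz1 : 0 ≤ ζ x ^ (2 * k) := pow_nonneg hζx.1 _
    have hz2 : 0 ≤ ζ x ^ (2 * k + 1 + 1) := pow_nonneg hζx.1 _
    have hz3 : ζ x ^ (2 * k + 1 + 1) ≤ ζ x ^ (2 * k) :=
      pow_le_pow_of_le_one hζx.1 hζx.2 (by omega)
    set z := ζ x ^ (2 * k)
    set z' := ζ x ^ (2 * k + 1 + 1)
    have e1 : X * ∑ i, partialDeriv i (fun x => ζ x ^ (k + 1)) x ^ 2 ≤ X * (M * z) :=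
      mul_le_mul_of_nonneg_left hd1 hX.le
    have e2 := mul_le_mul_of_nonneg_right hψ1 hz2
    have e3 : -(Ψ (u x) * ∑ i, partialDeriv i (partialDeriv i
        (fun x => ζ x ^ (2 * k + 1 + 1))) x) ≤ (C * X) * (M * z) := by
      refine (neg_le_abs _).trans ?_
      rw [abs_mul]
      exact mul_le_mul hΨ1 hd2 (abs_nonneg _) (by positivity)
    have e4 : C * X * z' ≤ C * X * z := mul_le_mul_of_nonneg_left hz3 (by positivity)
    have e5 : X * z' ≤ X * z := mul_le_mul_of_nonneg_left hz3 hX.le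
    have e6 : s / C₂ * ((f (u x) + 1) ^ γ * (X * z')) ≤ s * ((f' (u x) + 1) * (X * z')) := by
      have := mul_le_mul_of_nonneg_right (mul_le_mul_of_nonneg_left hp (div_pos hs0 hC₂).le)
        (by positivity : 0 ≤ X * z')
      calc _ = s / C₂ * (f (u x) + 1) ^ γ * (X * z') := by ring
        _ ≤ _ := this
        _ = _ := by field_simp
    have hYZ : X * z ≤ 2 * s * (f' (u x) * X * z') + 2 * K := by
      have : s * (X * z') ≤ 1 / 2 * (X * z) :=
        mul_le_mul hs1 e5 (by positivity) (by norm_num)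
      linarith
    have hZ0 : 0 ≤ f' (u x) * X * z' := by positivity
    have e7 := mul_le_mul_of_nonneg_left hYZ (by linarith : 0 ≤ A + 1)
    have e8 := mul_le_mul_of_nonneg_right hs2 hZ0
    simp only [hA] at e7 e8 ⊢
    linarith
  have hQ0 : ∀ x ∉ closedBall (0 : EuclideanSpace ℝ (Fin n)) (15 / 16), Q x = 0 := fun x hx => by
    obtain ⟨hd1, hd2⟩ := hζd x
    have h1 : ζ x ^ (2 * k) = 0 := by simp [hζ0 x hx, hk0]
    rw [h1, mul_zero] at hd1 hd2
    have h2 : ∑ i, partialDeriv i (fun x => ζ x ^ (k + 1)) x ^ 2 = 0 :=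
      hd1.antisymm (Finset.sum_nonneg fun i _ => sq_nonneg _)
    have h3 := abs_eq_zero.1 (hd2.antisymm (abs_nonneg _))
    simp only [hQdef]
    rw [h2, h3, hζ0 x hx]
    simp
  have hWint : ∫ x, W x ≤ 2 * (A + 1) * K *
      volume.real (closedBall (0 : EuclideanSpace ℝ (Fin n)) (15 / 16)) := by
    calc ∫ x, W x ≤ ∫ x, (W x + Q x) := by rw [integral_add hWi hQi]; linarith
      _ = ∫ x in closedBall 0 (15 / 16), (W x + Q x) :=
        (setIntegral_eq_integral_of_forall_compl_eq_zero fun x hx => by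
          simp [hQ0 x hx, hWdef, hζ0 x hx, hk0]).symm
      _ ≤ ∫ x in closedBall (0 : EuclideanSpace ℝ (Fin n)) (15 / 16), 2 * (A + 1) * K :=
        setIntegral_mono_on (hWi.add hQi).integrableOn (integrableOn_const hcpt.measure_ne_top)
          measurableSet_closedBall hpt
      _ = _ := by rw [setIntegral_const, smul_eq_mul, mul_comm]
  rw [← div_eq_inv_mul, le_div_iff₀ hc0, ← integral_mul_const]
  refine le_trans ?_ hWint
  refine le_trans ?_ (setIntegral_le_integral (s := closedBall 0 (7 / 8)) hWi
    (Eventually.of_forall hW0))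
  have hsub' : closedBall (0 : EuclideanSpace ℝ (Fin n)) (7 / 8) ⊆ ball 0 1 :=
    closedBall_subset_ball (by norm_num)
  refine setIntegral_mono_on ?_ hWi.integrableOn measurableSet_closedBall fun x hx => ?_
  · refine ContinuousOn.integrableOn_compact (isCompact_closedBall _ _) (ContinuousOn.mono ?_ hsub')
    exact (((hmapsc hC2.continuousOn_deriv).add continuousOn_const).mul (hmapsc hXc)).mul
      continuousOn_const
  · have h1 := hX0 x (hsub' hx)
    have h2 := hf'0 _ (hmaps (hsub' hx))
    simp only [hWdef, hζ1 x hx, one_pow, mul_one]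
    have h3 := mul_le_mul_of_nonneg_right (min_le_left ((1 - κ) / 2) 1) (mul_nonneg h2 h1.le)
    have h4 := mul_le_mul_of_nonneg_right (min_le_right ((1 - κ) / 2) 1) h1.le
    linarith

lemma exists_radial_kernel (n : ℕ) :
    ∃ (Φ ψ : EuclideanSpace ℝ (Fin n) → ℝ) (B : ℝ), ContDiff ℝ 1 Φ ∧ Continuous ψ ∧
      (∀ y i, partialDeriv i Φ y = -(y i * ψ y)) ∧ (∀ y, 0 ≤ Φ y ∧ Φ y ≤ B) ∧
      (∀ y, 0 ≤ ψ y ∧ ψ y ≤ B) ∧ (∀ y ∉ ball 0 1, Φ y = 0 ∧ ψ y = 0) ∧ 0 < ∫ y, ψ y := by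
  set g : ℝ → ℝ := fun s => ∫ t in (0 : ℝ)..s, max t 0 with hg
  have hmax : Continuous fun t : ℝ => max t 0 := continuous_id.max continuous_const
  have hgd : ∀ s, HasDerivAt g (max s 0) s := fun s =>
    intervalIntegral.integral_hasDerivAt_right (hmax.intervalIntegrable _ _)
      (hmax.stronglyMeasurableAtFilter _ _) hmax.continuousAt
  have hg1 : ContDiff ℝ 1 g := by
    refine contDiff_one_iff_deriv.2 ⟨fun s => (hgd s).differentiableAt, ?_⟩
    rwa [show deriv g = fun s => max s 0 from funext fun s => (hgd s).deriv]
  have hgmono : Monotone g := monotone_of_deriv_nonneg (fun s => (hgd s).differentiableAt)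
    fun s => by rw [(hgd s).deriv]; exact le_max_right _ _
  have hg0 : ∀ s ≤ 0, g s = 0 := fun s hs => by
    rw [hg]
    refine (intervalIntegral.integral_congr (g := fun _ => (0 : ℝ)) fun t ht => ?_).trans (by simp)
    rw [uIcc_of_ge hs] at ht
    exact max_eq_right ht.2
  have hN : ContDiff ℝ 1 fun y : EuclideanSpace ℝ (Fin n) => 1 - ‖y‖ ^ 2 :=
    contDiff_const.sub (contDiff_norm_sq ℝ)
  have hout : ∀ y ∉ ball (0 : EuclideanSpace ℝ (Fin n)) 1, 1 - ‖y‖ ^ 2 ≤ 0 := fun y hy => by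
    rw [mem_ball_zero_iff, not_lt] at hy
    nlinarith
  have hψc : Continuous fun y : EuclideanSpace ℝ (Fin n) => 2 * max (1 - ‖y‖ ^ 2) 0 :=
    continuous_const.mul (hmax.comp hN.continuous)
  have hψ0 : ∀ y : EuclideanSpace ℝ (Fin n), 0 ≤ 2 * max (1 - ‖y‖ ^ 2) 0 := fun y => by positivity
  have hψout : ∀ y ∉ ball (0 : EuclideanSpace ℝ (Fin n)) 1, 2 * max (1 - ‖y‖ ^ 2) 0 = 0 :=
    fun y hy => by rw [max_eq_right (hout y hy), mul_zero]
  refine ⟨fun y => g (1 - ‖y‖ ^ 2), fun y => 2 * max (1 - ‖y‖ ^ 2) 0, max (g 1) 2, hg1.comp hN, hψc,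
    fun y i => ?_, fun y => ⟨?_, ?_⟩, fun y => ⟨hψ0 y, ?_⟩, fun y hy => ⟨hg0 _ (hout y hy),
    hψout y hy⟩, ?_⟩
  · have h1 : HasFDerivAt (fun y : EuclideanSpace ℝ (Fin n) => 1 - ‖y‖ ^ 2)
        (-(2 • innerSL ℝ y)) y := (hasStrictFDerivAt_norm_sq y).hasFDerivAt.const_sub 1
    have h2 := (hgd (1 - ‖y‖ ^ 2)).comp_hasFDerivAt y h1
    have h3 : partialDeriv i (fun y => g (1 - ‖y‖ ^ 2)) y = _ := congrArg
      (fun L : EuclideanSpace ℝ (Fin n) →L[ℝ] ℝ => L (EuclideanSpace.single i 1)) h2.fderiv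
    rw [h3]
    simp [EuclideanSpace.inner_single_right]
    ring
  · rw [← hg0 0 le_rfl]
    rcases le_total 0 (1 - ‖y‖ ^ 2) with h | h
    · exact hgmono h
    · simp only [hg0 _ h, hg0 0 le_rfl, le_refl]
  · exact (hgmono (by linarith [sq_nonneg ‖y‖])).trans (le_max_left _ _)
  · refine le_trans ?_ (le_max_right _ _)
    have : max (1 - ‖y‖ ^ 2) 0 ≤ 1 := max_le (by linarith [sq_nonneg ‖y‖]) zero_le_one
    linarith
  · refine (hψc.integral_pos_of_hasCompactSupport_nonneg_nonzero ?_ hψ0 (x := 0) (by simp))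
    refine HasCompactSupport.intro (isCompact_closedBall 0 1) fun y hy => hψout y fun h => hy ?_
    exact ball_subset_closedBall h

section LocalMaximum

variable {n : ℕ}

lemma add_smul_mem_closedBall {x₀ y : EuclideanSpace ℝ (Fin n)} {r R : ℝ} (hr : 0 ≤ r)
    (hrR : r ≤ R) (hy : y ∈ closedBall 0 1) : x₀ + r • y ∈ closedBall x₀ R := by
  rw [mem_closedBall_zero_iff] at hy
  rw [mem_closedBall, dist_self_add_left, norm_smul, Real.norm_of_nonneg hr]
  exact (mul_le_of_le_one_right hr hy).trans hrR

lemma partialDeriv_comp_add_smul {v : EuclideanSpace ℝ (Fin n) → ℝ}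
    {x₀ y : EuclideanSpace ℝ (Fin n)} {r : ℝ} (hv : DifferentiableAt ℝ v (x₀ + r • y)) (i : Fin n) :
    partialDeriv i (fun y => v (x₀ + r • y)) y = r * partialDeriv i v (x₀ + r • y) := by
  have h1 : HasFDerivAt (fun y : EuclideanSpace ℝ (Fin n) => x₀ + r • y)
      (r • ContinuousLinearMap.id ℝ _) y := ((hasFDerivAt_id y).const_smul r).const_add x₀
  have h2 := hv.hasFDerivAt.comp y h1
  have h3 : partialDeriv i (fun y => v (x₀ + r • y)) y = _ := congrArg
    (fun L : EuclideanSpace ℝ (Fin n) →L[ℝ] ℝ => L (EuclideanSpace.single i 1)) h2.fderiv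
  rw [h3]
  simp [partialDeriv]

lemma fderiv_apply_eq_sum (w : EuclideanSpace ℝ (Fin n) → ℝ) (z y : EuclideanSpace ℝ (Fin n)) :
    fderiv ℝ w z y = ∑ i, partialDeriv i w z * y i := by
  have h := (EuclideanSpace.basisFun (Fin n) ℝ).sum_repr y
  conv_lhs => rw [← h]
  rw [map_sum]
  refine Finset.sum_congr rfl fun i _ => ?_
  simp [partialDeriv, mul_comm]

variable {Φ ψ : EuclideanSpace ℝ (Fin n) → ℝ} {w : EuclideanSpace ℝ (Fin n) → ℝ}
  {U : Set (EuclideanSpace ℝ (Fin n))} {x₀ : EuclideanSpace ℝ (Fin n)} {r R : ℝ}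

lemma integral_radial_deriv_eq (hΦ : ContDiff ℝ 1 Φ)
    (hd : ∀ y i, partialDeriv i Φ y = -(y i * ψ y)) (h0 : ∀ y ∉ ball 0 1, Φ y = 0)
    (hU : IsOpen U) (hw : ContDiffOn ℝ 2 w U) (hr : 0 ≤ r) (hb : closedBall x₀ r ⊆ U) :
    ∫ y, (∑ i, partialDeriv i w (x₀ + r • y) * y i) * ψ y =
      r * ∫ y, lap w (x₀ + r • y) * Φ y := by
  set Ω : Set (EuclideanSpace ℝ (Fin n)) := (fun y => x₀ + r • y) ⁻¹' U with hΩdef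
  have haff : ContDiff ℝ (⊤ : ℕ∞) fun y : EuclideanSpace ℝ (Fin n) => x₀ + r • y :=
    contDiff_const.add (contDiff_id.const_smul r)
  have hΩ : IsOpen Ω := hU.preimage haff.continuous
  have hts : tsupport Φ ⊆ closedBall 0 1 := by
    refine closure_minimal (fun y hy => ?_) isClosed_closedBall
    by_contra hy'
    exact hy (h0 y fun h => hy' (ball_subset_closedBall h))
  have hs : tsupport Φ ⊆ Ω := fun y hy => hb (add_smul_mem_closedBall hr le_rfl (hts hy))
  have hc : HasCompactSupport Φ :=
    (isCompact_closedBall 0 1).of_isClosed_subset (isClosed_tsupport _) hts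
  have hdw : ∀ i, ContDiffOn ℝ 1 (partialDeriv i w) U := fun i =>
    ContDiffOn.partialDeriv hU hw (by norm_num) i
  have hibp := fun i => integral_partialDeriv_mul_add hΩ
    (a := fun y => partialDeriv i w (x₀ + r • y))
    ((hdw i).comp (contDiff_infty.1 haff 1).contDiffOn fun y hy => hy) hΦ hc hs i
  have h1 : ∀ y, (∑ i, partialDeriv i w (x₀ + r • y) * y i) * ψ y =
      ∑ i, -(partialDeriv i w (x₀ + r • y) * partialDeriv i Φ y) := fun y => by
    rw [Finset.sum_mul]
    refine Finset.sum_congr rfl fun i _ => ?_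
    rw [hd]
    ring
  have h2 : ∀ y, r * (lap w (x₀ + r • y) * Φ y) =
      ∑ i, partialDeriv i (fun y => partialDeriv i w (x₀ + r • y)) y * Φ y := fun y => by
    rw [lap_eq_sum_partialDeriv, Finset.sum_mul, Finset.mul_sum]
    refine Finset.sum_congr rfl fun i _ => ?_
    by_cases hy : y ∈ ball 0 1
    · rw [partialDeriv_comp_add_smul]
      · ring
      · exact ((hdw i).differentiableOn one_ne_zero).differentiableAt
          (hU.mem_nhds (hb (add_smul_mem_closedBall hr le_rfl (ball_subset_closedBall hy))))
    · simp [h0 y hy]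
  rw [← integral_const_mul, integral_congr_ae (Eventually.of_forall h1),
    integral_congr_ae (Eventually.of_forall h2)]
  refine (integral_finsetSum _ fun i _ => (hibp i).2.1.neg).trans ?_
  rw [integral_finsetSum _ fun i _ => (hibp i).1]
  refine Finset.sum_congr rfl fun i _ => ?_
  refine (integral_neg _).trans ?_
  rw [(hibp i).2.2, neg_neg]

lemma mul_integral_kernel_le {B K s : ℝ} (hΦ : ContDiff ℝ 1 Φ) (hψ : Continuous ψ)
    (hd : ∀ y i, partialDeriv i Φ y = -(y i * ψ y)) (hψB : ∀ y, 0 ≤ ψ y ∧ ψ y ≤ B)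
    (h0 : ∀ y ∉ ball 0 1, Φ y = 0 ∧ ψ y = 0)
    (hU : IsOpen U) (hw : ContDiffOn ℝ 2 w U) (hR : 0 < R) (hb : closedBall x₀ R ⊆ U) (hs : 0 < s)
    (hK : ∀ r ∈ Ioo 0 R, r * ∫ y, -lap w (x₀ + r • y) * Φ y ≤ K * (s * r ^ (s - 1))) :
    w x₀ * ∫ y, ψ y ≤ (∫ y, w (x₀ + R • y) * ψ y) + K * R ^ s := by
  have hw1 : ContDiffOn ℝ 1 w U := hw.of_le (by norm_num)
  have hdw : ∀ i, ContinuousOn (partialDeriv i w) U := fun i =>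
    (ContDiffOn.partialDeriv hU hw (m := 1) (by norm_num) i).continuousOn
  have hcpt : IsCompact (closedBall (0 : EuclideanSpace ℝ (Fin n)) 1) := isCompact_closedBall _ _
  have h0' : ∀ y ∉ closedBall (0 : EuclideanSpace ℝ (Fin n)) 1, ψ y = 0 := fun y hy =>
    (h0 y fun h => hy (ball_subset_closedBall h)).2
  have hmaps : ∀ r ∈ Icc 0 R, MapsTo (fun y => x₀ + r • y) (closedBall 0 1) (closedBall x₀ R) :=
    fun r hr y hy => add_smul_mem_closedBall hr.1 hr.2 hy
  have haff : ∀ r : ℝ, Continuous fun y : EuclideanSpace ℝ (Fin n) => x₀ + r • y := fun r => by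
    fun_prop
  have hFi : ∀ r ∈ Icc 0 R, Integrable fun y => w (x₀ + r • y) * ψ y := fun r hr =>
    integrable_of_continuousOn_of_eq_zero hcpt
      (((hw1.continuousOn.mono hb).comp (haff r).continuousOn (hmaps r hr)).mul hψ.continuousOn)
      fun y hy => by simp [h0' y hy]
  have hψi : Integrable ψ :=
    integrable_of_continuousOn_of_eq_zero hcpt hψ.continuousOn h0'
  have hF'i : ∀ r ∈ Icc 0 R,
      Integrable fun y => (∑ i, partialDeriv i w (x₀ + r • y) * y i) * ψ y := fun r hr => by
    refine integrable_of_continuousOn_of_eq_zero hcpt (ContinuousOn.mul ?_ hψ.continuousOn)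
      fun y hy => by simp [h0' y hy]
    refine continuousOn_finsetSum _ fun i _ => ?_
    exact (((hdw i).mono hb).comp (haff r).continuousOn (hmaps r hr)).mul (by fun_prop)
  obtain ⟨M₀, hM₀⟩ := (isCompact_closedBall x₀ R).exists_bound_of_continuousOn
    (hw1.continuousOn.mono hb)
  obtain ⟨M₁, hM₁⟩ := (isCompact_closedBall x₀ R).exists_bound_of_continuousOn
    (f := fun z => ∑ i, |partialDeriv i w z|)
    (continuousOn_finsetSum _ fun i _ => ((hdw i).mono hb).abs)
  have hderiv : ∀ r ∈ Ioo 0 R, HasDerivAt (fun r => ∫ y, w (x₀ + r • y) * ψ y)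
      (∫ y, (∑ i, partialDeriv i w (x₀ + r • y) * y i) * ψ y) r := fun r hr => by
    refine (hasDerivAt_integral_of_dominated_loc_of_deriv_le (s := Ioo 0 R)
      (bound := fun y => M₁ * ψ y)
      (F' := fun r y => (∑ i, partialDeriv i w (x₀ + r • y) * y i) * ψ y) (Ioo_mem_nhds hr.1 hr.2)
      ?_ (hFi r (Ioo_subset_Icc_self hr)) (hF'i r (Ioo_subset_Icc_self hr)).aestronglyMeasurable
      (Eventually.of_forall fun y t ht => ?_) (hψi.const_mul _)
      (Eventually.of_forall fun y t ht => ?_)).2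
    · filter_upwards [Ioo_mem_nhds hr.1 hr.2] with t ht
      exact (hFi t (Ioo_subset_Icc_self ht)).aestronglyMeasurable
    · by_cases hy : y ∈ closedBall 0 1
      · have h1 := hM₁ _ (hmaps t (Ioo_subset_Icc_self ht) hy)
        rw [Real.norm_of_nonneg (Finset.sum_nonneg fun i _ => abs_nonneg _)] at h1
        rw [norm_mul, Real.norm_of_nonneg (hψB y).1]
        refine mul_le_mul_of_nonneg_right (le_trans ?_ h1) (hψB y).1
        refine (norm_sum_le _ _).trans (Finset.sum_le_sum fun i _ => ?_)
        rw [norm_mul, Real.norm_eq_abs]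
        exact mul_le_of_le_one_right (abs_nonneg _)
          ((PiLp.norm_apply_le y i).trans (mem_closedBall_zero_iff.1 hy))
      · simp [h0' y hy]
    · by_cases hy : y ∈ closedBall 0 1
      · have hz := hb (hmaps t (Ioo_subset_Icc_self ht) hy)
        have h1 := ((hw1.differentiableOn one_ne_zero).differentiableAt
          (hU.mem_nhds hz)).hasFDerivAt
        have h2 : HasDerivAt (fun t : ℝ => x₀ + t • y) y t := by
          simpa using ((hasDerivAt_id t).smul_const y).const_add x₀
        have h3 := (h1.comp_hasDerivAt t h2).mul_const (ψ y)
        rwa [fderiv_apply_eq_sum] at h3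
      · simp only [h0' y hy, mul_zero]
        exact hasDerivAt_const t 0
  have hcont : ContinuousOn (fun r => ∫ y, w (x₀ + r • y) * ψ y) (Icc 0 R) := by
    refine continuousOn_of_dominated (bound := fun y => M₀ * ψ y)
      (fun r hr => (hFi r hr).aestronglyMeasurable)
      (fun r hr => Eventually.of_forall fun y => ?_) (hψi.const_mul _)
      (Eventually.of_forall fun y => ?_)
    · by_cases hy : y ∈ closedBall 0 1
      · rw [norm_mul, Real.norm_of_nonneg (hψB y).1]
        exact mul_le_mul_of_nonneg_right (hM₀ _ (hmaps r hr hy)) (hψB y).1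
      · simp [h0' y hy]
    · by_cases hy : y ∈ closedBall 0 1
      · exact ((hw1.continuousOn.mono hb).comp (by fun_prop)
          fun r hr => hmaps r hr hy).mul continuousOn_const
      · simp only [h0' y hy, mul_zero]
        exact continuousOn_const
  have hmono : MonotoneOn (fun r => (∫ y, w (x₀ + r • y) * ψ y) + K * r ^ s) (Icc 0 R) := by
    have hder : ∀ r ∈ Ioo 0 R, HasDerivAt (fun r => (∫ y, w (x₀ + r • y) * ψ y) + K * r ^ s)
        ((∫ y, (∑ i, partialDeriv i w (x₀ + r • y) * y i) * ψ y) + K * (s * r ^ (s - 1))) r :=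
      fun r hr => (hderiv r hr).add ((Real.hasDerivAt_rpow_const (Or.inl hr.1.ne')).const_mul K)
    refine monotoneOn_of_deriv_nonneg (convex_Icc 0 R) (hcont.add (continuousOn_const.mul
      (continuousOn_id.rpow_const fun _ _ => Or.inr hs.le))) ?_ ?_
    · rw [interior_Icc]
      exact fun r hr => (hder r hr).differentiableAt.differentiableWithinAt
    · rw [interior_Icc]
      intro r hr
      rw [(hder r hr).deriv, integral_radial_deriv_eq hΦ hd (fun y hy => (h0 y hy).1) hU hw hr.1.le
        ((closedBall_subset_closedBall hr.2.le).trans hb)]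
      have := hK r hr
      simp only [neg_mul, integral_neg, mul_neg] at this
      linarith
  have := hmono ⟨le_rfl, hR.le⟩ ⟨hR.le, le_rfl⟩ hR.le
  simp only [zero_smul, add_zero, Real.zero_rpow hs.ne', mul_zero, integral_const_mul] at this
  exact this

end LocalMaximum

section LocalBound

variable {n : ℕ}

lemma integral_comp_add_smul_mul_le {h χ : EuclideanSpace ℝ (Fin n) → ℝ} {B r : ℝ}
    {x₀ : EuclideanSpace ℝ (Fin n)} (hr : 0 < r) (hh : ContinuousOn h (closedBall x₀ r))
    (hh0 : ∀ x ∈ closedBall x₀ r, 0 ≤ h x) (hχ : ∀ y, 0 ≤ χ y ∧ χ y ≤ B)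
    (hχ0 : ∀ y ∉ ball 0 1, χ y = 0) :
    ∫ y, h (x₀ + r • y) * χ y ≤ B * ((r ^ n)⁻¹ * ∫ x in closedBall x₀ r, h x) := by
  set g := (closedBall x₀ r).indicator h with hg
  have hgi : Integrable g :=
    (hh.integrableOn_compact (isCompact_closedBall _ _)).integrable_indicator
      measurableSet_closedBall
  have hB : 0 ≤ B := (hχ 0).1.trans (hχ 0).2
  have hg0 : ∀ x, 0 ≤ g x := fun x => indicator_nonneg hh0 x
  have e : (r ^ n)⁻¹ * ∫ x in closedBall x₀ r, h x = ∫ y, g (x₀ + r • y) := by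
    rw [Measure.integral_comp_smul volume (fun y => g (x₀ + y)), integral_add_left_eq_self,
      finrank_euclideanSpace_fin, abs_of_nonneg (by positivity), smul_eq_mul, hg,
      integral_indicator measurableSet_closedBall]
  rw [e, ← integral_const_mul]
  have hmem : ∀ y ∈ ball (0 : EuclideanSpace ℝ (Fin n)) 1, x₀ + r • y ∈ closedBall x₀ r :=
    fun y hy => add_smul_mem_closedBall hr.le le_rfl (ball_subset_closedBall hy)
  refine integral_mono_of_nonneg (Eventually.of_forall fun y => ?_) ?_
    (Eventually.of_forall fun y => ?_)
  · by_cases hy : y ∈ ball 0 1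
    · exact mul_nonneg (hh0 _ (hmem y hy)) (hχ y).1
    · simp [hχ0 y hy]
  · exact ((hgi.comp_add_left x₀).comp_smul hr.ne').const_mul B
  · by_cases hy : y ∈ ball 0 1
    · simp only [hg, indicator_of_mem (hmem y hy)]
      rw [mul_comm]
      exact mul_le_mul_of_nonneg_right (hχ y).2 (hh0 _ (hmem y hy))
    · simp only [hχ0 y hy, mul_zero]
      exact mul_nonneg hB (hg0 _)

lemma le_add_rpow_mul_rpow {l V q : ℝ} (hl : 0 < l) (hV : 0 ≤ V) (hq : 1 < q) :
    V ≤ l + l ^ (1 - q) * V ^ q := by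
  rcases le_total V l with h | h
  · have : 0 ≤ l ^ (1 - q) * V ^ q := by positivity
    linarith
  · have hV0 : 0 < V := hl.trans_le h
    have h1 : V ^ (1 - q) ≤ l ^ (1 - q) := Real.rpow_le_rpow_of_nonpos hl h (by linarith)
    have h2 := mul_le_mul_of_nonneg_right h1 (Real.rpow_nonneg hV q)
    rw [← Real.rpow_add hV0, sub_add_cancel, Real.rpow_one] at h2
    linarith

lemma continuousOn_lap {w : EuclideanSpace ℝ (Fin n) → ℝ} {U : Set (EuclideanSpace ℝ (Fin n))}
    (hU : IsOpen U) (hw : ContDiffOn ℝ 2 w U) : ContinuousOn (lap w) U := by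
  refine continuousOn_finsetSum _ fun i _ => ?_
  exact (ContDiffOn.partialDeriv hU (ContDiffOn.partialDeriv hU hw (m := 1) (by norm_num) i)
    (m := 0) (by norm_num) i).continuousOn

lemma exists_pointwise_bound (n : ℕ) {q I : ℝ} (hq : 1 < q) (hnq : (n : ℝ) < 2 * q) :
    ∃ C, 0 ≤ C ∧ ∀ (w V : EuclideanSpace ℝ (Fin n) → ℝ) (U : Set (EuclideanSpace ℝ (Fin n)))
      (x₀ : EuclideanSpace ℝ (Fin n)) (R M : ℝ), IsOpen U → ContDiffOn ℝ 2 w U → 0 < R →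
      closedBall x₀ R ⊆ U → ContinuousOn V (closedBall x₀ R) →
      (∀ x ∈ closedBall x₀ R, 0 ≤ V x ∧ 0 ≤ w x ∧ w x ≤ M ∧ -lap w x ≤ V x * w x) →
      ∫ x in closedBall x₀ R, V x ^ q ≤ I →
      w x₀ ≤ C * ((R ^ n)⁻¹ * (∫ x in closedBall x₀ R, w x) + M * R ^ (2 - n / q)) := by
  obtain ⟨Φ, ψ, B, hΦ, hψ, hd, hΦB, hψB, h0, hint⟩ := exists_radial_kernel n
  have hB : 0 ≤ B := (hψB 0).1.trans (hψB 0).2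
  have hq0 : 0 < q := one_pos.trans hq
  set s := 2 - n / q with hs
  have hs0 : 0 < s := by
    have : n / q < 2 := by rwa [div_lt_iff₀ hq0]
    linarith
  set v := volume.real (closedBall (0 : EuclideanSpace ℝ (Fin n)) 1) with hv
  have hv0 : 0 ≤ v := measureReal_nonneg
  refine ⟨(∫ y, ψ y)⁻¹ * (B + B * (v + |I|) / s), by positivity,
    fun w V U x₀ R M hU hw hR hb hV hx hI => ?_⟩
  have hI0 : 0 ≤ |I| := abs_nonneg I
  have hx₀ : x₀ ∈ closedBall x₀ R := mem_closedBall_self hR.le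
  have hM : 0 ≤ M := (hx x₀ hx₀).2.1.trans (hx x₀ hx₀).2.2.1
  have hVq : ContinuousOn (fun x => V x ^ q) (closedBall x₀ R) :=
    hV.rpow_const fun _ _ => Or.inr hq0.le
  have hVq0 : ∀ x ∈ closedBall x₀ R, 0 ≤ V x ^ q := fun x h => Real.rpow_nonneg (hx x h).1 _
  have hK : ∀ r ∈ Ioo 0 R, r * ∫ y, -lap w (x₀ + r • y) * Φ y ≤
      M * (B * (v + |I|) / s) * (s * r ^ (s - 1)) := by
    intro r hr
    have hr0 := hr.1
    have hsub : closedBall x₀ r ⊆ closedBall x₀ R := closedBall_subset_closedBall hr.2.le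
    set l := r ^ (-(n / q)) with hl
    have hl0 : 0 < l := Real.rpow_pos_of_pos hr0 _
    set h : EuclideanSpace ℝ (Fin n) → ℝ := fun x => M * (l + l ^ (1 - q) * V x ^ q) with hh
    have hlq : 0 ≤ l ^ (1 - q) := Real.rpow_nonneg hl0.le _
    have hhc : ContinuousOn h (closedBall x₀ r) := continuousOn_const.mul
      (continuousOn_const.add (continuousOn_const.mul (hVq.mono hsub)))
    have hh0 : ∀ x ∈ closedBall x₀ r, 0 ≤ h x := fun x hxr => by
      have := hVq0 x (hsub hxr)
      positivity
    have h1 := integral_comp_add_smul_mul_le hr0 hhc hh0 hΦB fun y hy => (h0 y hy).1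
    have h2 : ∫ x in closedBall x₀ r, h x ≤ M * (l * (r ^ n * v) + l ^ (1 - q) * |I|) := by
      rw [integral_const_mul]
      refine mul_le_mul_of_nonneg_left ?_ hM
      have i1 : IntegrableOn (fun x => V x ^ q) (closedBall x₀ r) :=
        (hVq.mono hsub).integrableOn_compact (isCompact_closedBall _ _)
      have i0 : IntegrableOn (fun _ : EuclideanSpace ℝ (Fin n) => l) (closedBall x₀ r) :=
        integrableOn_const (isCompact_closedBall _ _).measure_ne_top
      rw [integral_add i0 (i1.const_mul _), setIntegral_const, integral_const_mul, smul_eq_mul,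
        Measure.addHaar_real_closedBall' _ _ hr0.le, finrank_euclideanSpace_fin]
      have i2 : ∫ x in closedBall x₀ r, V x ^ q ≤ |I| := by
        refine le_trans ?_ (hI.trans (le_abs_self I))
        refine setIntegral_mono_set (hVq.integrableOn_compact (isCompact_closedBall _ _)) ?_
          hsub.eventuallyLE
        filter_upwards [ae_restrict_mem measurableSet_closedBall] with x hx using hVq0 x hx
      have := mul_le_mul_of_nonneg_left i2 hlq
      linarith
    have h3 : ∫ y, -lap w (x₀ + r • y) * Φ y ≤ ∫ y, h (x₀ + r • y) * Φ y := by
      have hmaps : MapsTo (fun y => x₀ + r • y) (closedBall 0 1) (closedBall x₀ r) :=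
        fun y hy => add_smul_mem_closedBall hr0.le le_rfl hy
      have haff : Continuous fun y : EuclideanSpace ℝ (Fin n) => x₀ + r • y := by fun_prop
      have hout : ∀ y ∉ closedBall (0 : EuclideanSpace ℝ (Fin n)) 1, Φ y = 0 := fun y hy =>
        (h0 y fun h => hy (ball_subset_closedBall h)).1
      refine integral_mono ?_ ?_ fun y => ?_
      · exact integrable_of_continuousOn_of_eq_zero (isCompact_closedBall 0 1)
          (((((continuousOn_lap hU hw).mono (hsub.trans hb)).comp haff.continuousOn hmaps).neg).mul
            hΦ.continuous.continuousOn) fun y hy => by simp [hout y hy]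
      · exact integrable_of_continuousOn_of_eq_zero (isCompact_closedBall 0 1)
          ((hhc.comp haff.continuousOn hmaps).mul
            hΦ.continuous.continuousOn) fun y hy => by simp [hout y hy]
      · by_cases hy : y ∈ closedBall 0 1
        · obtain ⟨k1, k2, k3, k4⟩ := hx _ (hsub (hmaps hy))
          refine mul_le_mul_of_nonneg_right (k4.trans ?_) (hΦB y).1
          calc _ ≤ V (x₀ + r • y) * M := mul_le_mul_of_nonneg_left k3 k1
            _ = M * V (x₀ + r • y) := mul_comm _ _
            _ ≤ _ := mul_le_mul_of_nonneg_left (le_add_rpow_mul_rpow hl0 k1 hq) hM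
        · simp [hout y hy]
    have h4 : l ^ (1 - q) * (r ^ n)⁻¹ = l := by
      rw [hl, ← Real.rpow_mul hr0.le, ← Real.rpow_natCast, ← Real.rpow_neg hr0.le,
        ← Real.rpow_add hr0]
      congr 1
      field_simp
      ring
    have h5 : r * l = r ^ (s - 1) := by
      nth_rewrite 1 [← Real.rpow_one r]
      rw [hl, ← Real.rpow_add hr0, hs]
      congr 1
      ring
    calc r * ∫ y, -lap w (x₀ + r • y) * Φ y ≤
        r * (B * ((r ^ n)⁻¹ * (M * (l * (r ^ n * v) + l ^ (1 - q) * |I|)))) := by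
          refine mul_le_mul_of_nonneg_left (h3.trans (h1.trans ?_)) hr0.le
          gcongr
      _ = M * B * (r * (l * v * ((r ^ n)⁻¹ * r ^ n) + l ^ (1 - q) * (r ^ n)⁻¹ * |I|)) := by ring
      _ = M * B * (v + |I|) * (r * l) := by
          rw [h4, inv_mul_cancel₀ (by positivity)]
          ring
      _ = _ := by
          rw [h5]
          field_simp
  have h1 := mul_integral_kernel_le hΦ hψ hd hψB h0 hU hw hR hb hs0 hK
  have h2 := integral_comp_add_smul_mul_le hR
    ((hw.continuousOn).mono hb) (fun x h => (hx x h).2.1) hψB fun y hy => (h0 y hy).2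
  have h3 : 0 ≤ (R ^ n)⁻¹ * ∫ x in closedBall x₀ R, w x :=
    mul_nonneg (by positivity) (setIntegral_nonneg measurableSet_closedBall
      fun x h => (hx x h).2.1)
  have h4 : 0 ≤ M * R ^ s := by positivity
  rw [mul_assoc, ← div_eq_inv_mul, le_div_iff₀ hint]
  have h5 : 0 ≤ B * (v + |I|) / s * ((R ^ n)⁻¹ * ∫ x in closedBall x₀ R, w x) := by positivity
  have h6 : 0 ≤ B * (M * R ^ s) := by positivity
  linarith

end LocalBound

/-- Local boundedness of subsolutions of `-Δw ≤ V w` with `V ∈ L^q`, `q > n / 2`. -/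
lemma exists_local_maximum_bound {n : ℕ} (hn : 1 ≤ n) {q I ρ ρ' : ℝ} (hq : 1 < q)
    (hnq : (n : ℝ) < 2 * q) (hρ' : 0 ≤ ρ') (hρρ' : ρ' < ρ) (hρ1 : ρ ≤ 1) :
    ∃ C, 0 ≤ C ∧ ∀ (w V : EuclideanSpace ℝ (Fin n) → ℝ) (U : Set (EuclideanSpace ℝ (Fin n))),
      IsOpen U → ContDiffOn ℝ 2 w U → closedBall 0 ρ ⊆ U → ContinuousOn V (closedBall 0 ρ) →
      (∀ x ∈ closedBall 0 ρ, 0 ≤ V x ∧ 0 ≤ w x ∧ -lap w x ≤ V x * w x) →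
      ∫ x in closedBall 0 ρ, V x ^ q ≤ I →
      ∀ x ∈ closedBall 0 ρ', w x ≤ C * ∫ x in closedBall 0 ρ, w x := by
  obtain ⟨C₀, hC₀, hpt⟩ := exists_pointwise_bound n (I := I) hq hnq
  have hq0 : 0 < q := one_pos.trans hq
  set s := 2 - n / q with hs
  have hs0 : 0 < s := by
    have : n / q < 2 := by rwa [div_lt_iff₀ hq0]
    linarith
  obtain ⟨θ, hθ0, hθ1, hθ2⟩ : ∃ θ : ℝ, 0 < θ ∧ θ ≤ 1 / 2 ∧ C₀ * 2 ^ n * θ ^ s ≤ 1 / 2 := by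
    have h1 : Tendsto (fun θ : ℝ => C₀ * 2 ^ n * θ ^ s) (𝓝[>] 0) (𝓝 0) := by
      have := ((Real.continuousAt_rpow_const 0 s (Or.inr hs0.le)).tendsto.const_mul
        (C₀ * 2 ^ n)).mono_left (nhdsWithin_le_nhds (s := Ioi 0))
      rwa [Real.zero_rpow hs0.ne', mul_zero] at this
    obtain ⟨θ, h2, h3⟩ := ((h1.eventually (gt_mem_nhds (by norm_num : (0 : ℝ) < 1 / 2))).and
      (Ioo_mem_nhdsGT (by norm_num : (0 : ℝ) < 1 / 2))).exists
    exact ⟨θ, h3.1, h3.2.le, h2.le⟩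
  have hgap : 0 < ρ - ρ' := by linarith
  refine ⟨2 * C₀ * (θ ^ n)⁻¹ / (ρ - ρ') ^ n, by positivity,
    fun w V U hU hw hb hV hx hI x hxρ' => ?_⟩
  set J := ∫ x in closedBall 0 ρ, w x with hJ
  have hρ0 : 0 ≤ ρ := by linarith
  have hwc := hw.continuousOn.mono hb
  have hwi := hwc.integrableOn_compact (μ := volume) (isCompact_closedBall _ _)
  have hJ0 : 0 ≤ J := setIntegral_nonneg measurableSet_closedBall fun x h => (hx x h).2.1
  obtain ⟨x₀, hx₀, hmax⟩ := (isCompact_closedBall (0 : EuclideanSpace ℝ (Fin n)) ρ).exists_isMaxOn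
    ⟨0, mem_closedBall_self hρ0⟩ (f := fun x => (ρ - ‖x‖) ^ n * w x) (by fun_prop)
  set d := ρ - ‖x₀‖ with hd
  set S := d ^ n * w x₀ with hS
  have hmax' : ∀ y ∈ closedBall 0 ρ, (ρ - ‖y‖) ^ n * w y ≤ S := fun y hy => hmax hy
  have hxn := mem_closedBall_zero_iff.1 hxρ'
  have hxρ : x ∈ closedBall 0 ρ := closedBall_subset_closedBall hρρ'.le hxρ'
  rw [div_mul_eq_mul_div, le_div_iff₀ (by positivity), mul_comm]
  have hfin : (ρ - ρ') ^ n * w x ≤ S := by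
    refine le_trans ?_ (hmax' x hxρ)
    exact mul_le_mul_of_nonneg_right (pow_le_pow_left₀ hgap.le (by linarith) n) (hx x hxρ).2.1
  refine hfin.trans ?_
  have hd0 : 0 ≤ d := by linarith [mem_closedBall_zero_iff.1 hx₀]
  rcases hd0.eq_or_lt with hd0 | hd0
  · rw [hS, ← hd0, zero_pow (by omega), zero_mul]
    positivity
  have hd1 : d ≤ 1 := by linarith [norm_nonneg x₀]
  have hS0 : 0 ≤ S := mul_nonneg (by positivity) (hx x₀ hx₀).2.1
  have hnear : ∀ y ∈ closedBall x₀ (θ * d), d / 2 ≤ ρ - ‖y‖ := fun y hy => by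
    rw [mem_closedBall, dist_eq_norm] at hy
    have := norm_le_norm_add_norm_sub' y x₀
    have := mul_le_mul_of_nonneg_right hθ1 hd0.le
    linarith
  have hsub : closedBall x₀ (θ * d) ⊆ closedBall 0 ρ := fun y hy => by
    rw [mem_closedBall_zero_iff]
    linarith [hnear y hy]
  have hmain := hpt w V U x₀ (θ * d) (S * (2 / d) ^ n) hU hw (by positivity) (hsub.trans hb)
    (hV.mono hsub) (fun y hy => ?_) ?_
  · have h1 : ∫ y in closedBall x₀ (θ * d), w y ≤ J := by
      refine setIntegral_mono_set hwi ?_ hsub.eventuallyLE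
      filter_upwards [ae_restrict_mem measurableSet_closedBall] with y hy using (hx y hy).2.1
    have h2 : (θ * d) ^ s ≤ θ ^ s :=
      Real.rpow_le_rpow (by positivity) (mul_le_of_le_one_right hθ0.le hd1) hs0.le
    have h3 : S ≤ C₀ * ((θ ^ n)⁻¹ * J + S * 2 ^ n * θ ^ s) := by
      calc S ≤ d ^ n * (C₀ * (((θ * d) ^ n)⁻¹ * J + S * (2 / d) ^ n * θ ^ s)) := by
            refine mul_le_mul_of_nonneg_left (hmain.trans ?_) (by positivity)
            gcongr
        _ = _ := by
            rw [div_pow, mul_pow]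
            field_simp
    have h4 := mul_le_mul_of_nonneg_left hθ2 hS0
    have h5 : 2 * C₀ * (θ ^ n)⁻¹ * J = 2 * (C₀ * ((θ ^ n)⁻¹ * J)) := by ring
    linarith
  · obtain ⟨k1, k2, k3⟩ := hx y (hsub hy)
    refine ⟨k1, k2, ?_, k3⟩
    have h1 : (d / 2) ^ n * w y ≤ S := (mul_le_mul_of_nonneg_right
      (pow_le_pow_left₀ (by positivity) (hnear y hy) n) k2).trans (hmax' y (hsub hy))
    rw [← inv_div, inv_pow, ← div_eq_mul_inv, le_div_iff₀ (by positivity)]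
    linarith
  · refine le_trans (setIntegral_mono_set ?_ ?_ hsub.eventuallyLE) hI
    · exact (hV.rpow_const fun _ _ => Or.inr hq0.le).integrableOn_compact (isCompact_closedBall _ _)
    · filter_upwards [ae_restrict_mem measurableSet_closedBall] with y hy
      exact Real.rpow_nonneg (hx y hy).1 _

section Conclusion

variable {n : ℕ}

lemma contDiffOn_two_comp_Ico {G f f' : ℝ → ℝ} {u : EuclideanSpace ℝ (Fin n) → ℝ}
    {Ω : Set (EuclideanSpace ℝ (Fin n))} (hΩ : IsOpen Ω) (hu : ContDiffOn ℝ 2 u Ω)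
    (hmaps : MapsTo u Ω (Ico 0 1))
    (hG : ∀ t ∈ Ico (0 : ℝ) 1, HasDerivWithinAt G (f t) (Ico 0 1) t)
    (hf : ∀ t ∈ Ico (0 : ℝ) 1, HasDerivWithinAt f (f' t) (Ico 0 1) t)
    (hf' : ContinuousOn f' (Ico 0 1)) :
    ContDiffOn ℝ 2 (fun x => G (u x)) Ω ∧ ∀ x ∈ Ω, lap (fun x => G (u x)) x =
      f' (u x) * ∑ i, partialDeriv i u x ^ 2 + f (u x) * lap u x := by
  have hu1 : ContDiffOn ℝ 1 u Ω := hu.of_le (by norm_num)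
  obtain ⟨cG, dG⟩ := contDiffOn_comp_Ico hΩ hu1 hmaps hG
    fun t ht => (hf t ht).continuousWithinAt
  obtain ⟨cf, df⟩ := contDiffOn_comp_Ico hΩ hu1 hmaps hf hf'
  refine ⟨?_, fun x hx => ?_⟩
  · rw [show (2 : WithTop ℕ∞) = 1 + 1 by norm_num] at hu ⊢
    rw [contDiffOn_succ_iff_fderiv_of_isOpen hΩ] at hu ⊢
    refine ⟨cG.differentiableOn one_ne_zero, by simp, ?_⟩
    refine (cf.smul hu.2.2).congr fun x hx => ?_
    ext y
    change fderiv ℝ (fun x => G (u x)) x y = f (u x) * fderiv ℝ u x y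
    rw [fderiv_apply_eq_sum, fderiv_apply_eq_sum, Finset.mul_sum]
    exact Finset.sum_congr rfl fun i _ => by rw [dG x hx, mul_assoc]
  · rw [lap_eq_sum_partialDeriv, lap_eq_sum_partialDeriv, Finset.mul_sum, Finset.mul_sum,
      ← Finset.sum_add_distrib]
    refine Finset.sum_congr rfl fun i _ => ?_
    have h1 : partialDeriv i (fun y => G (u y)) =ᶠ[𝓝 x] fun y => f (u y) * partialDeriv i u y := by
      filter_upwards [hΩ.mem_nhds hx] with y hy using dG y hy i
    have h2 : partialDeriv i (partialDeriv i fun y => G (u y)) x =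
        partialDeriv i (fun y => f (u y) * partialDeriv i u y) x := by
      unfold partialDeriv at h1 ⊢
      rw [h1.fderiv_eq]
    have hd1 := (cf.differentiableOn one_ne_zero).differentiableAt (hΩ.mem_nhds hx)
    have hd2 := ((ContDiffOn.partialDeriv hΩ hu (m := 1) (by norm_num) i).differentiableOn
      one_ne_zero).differentiableAt (hΩ.mem_nhds hx)
    rw [h2, partialDeriv_mul hd1 hd2, df x hx]
    ring

lemma integral_mul_lap {u b : EuclideanSpace ℝ (Fin n) → ℝ}
    {Ω : Set (EuclideanSpace ℝ (Fin n))} (hΩ : IsOpen Ω) (hu : ContDiffOn ℝ 2 u Ω)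
    (hb : ContDiff ℝ 2 b) (hc : HasCompactSupport b) (hs : tsupport b ⊆ Ω) :
    Integrable (fun x => u x * lap b x) ∧ Integrable (fun x => lap u x * b x) ∧
      ∫ x, u x * lap b x = ∫ x, lap u x * b x := by
  have h1 := fun i => integral_partialDeriv_mul_add hΩ (hu.of_le (by norm_num))
    (ContDiff.partialDeriv hb (m := 1) (by norm_num) i)
    (hc.of_isClosed_subset (isClosed_tsupport _) (tsupport_partialDeriv_subset b i))
    ((tsupport_partialDeriv_subset b i).trans hs) i
  have h2 := fun i => integral_partialDeriv_mul_add hΩ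
    (ContDiffOn.partialDeriv hΩ hu (m := 1) (by norm_num) i) (hb.of_le (by norm_num)) hc hs i
  simp only [lap_eq_sum_partialDeriv, Finset.mul_sum, Finset.sum_mul]
  refine ⟨integrable_finsetSum _ fun i _ => (h1 i).2.1, integrable_finsetSum _ fun i _ => (h2 i).1,
    ?_⟩
  rw [integral_finsetSum _ fun i _ => (h1 i).2.1, integral_finsetSum _ fun i _ => (h2 i).1]
  refine Finset.sum_congr rfl fun i _ => ?_
  rw [(h1 i).2.2, (h2 i).2.2, neg_neg]

/-- The value of the nonlinearity at zero is controlled by the `L¹` norm of the solution. -/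
lemma exists_apply_zero_le (n : ℕ) {f : ℝ → ℝ} (hmono : MonotoneOn f (Ico 0 1))
    (hf0 : 0 ≤ f 0) :
    ∃ C, 0 ≤ C ∧ ∀ u : EuclideanSpace ℝ (Fin n) → ℝ, ContDiffOn ℝ 2 u (ball 0 1) →
      MapsTo u (ball 0 1) (Ico 0 1) → (∀ x ∈ ball 0 1, -lap u x = f (u x)) →
      IntegrableOn u (ball 0 1) → f 0 ≤ C * ∫ x in ball 0 1, u x := by
  obtain ⟨ζ, M, hζ, hζ01, hζ1, hζs, hM, hζd⟩ := exists_cutoff n 0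
  set v := volume.real (closedBall (0 : EuclideanSpace ℝ (Fin n)) (7 / 8)) with hv
  have hv0 : 0 < v := ENNReal.toReal_pos
    (measure_closedBall_pos volume _ (by norm_num)).ne' (isCompact_closedBall _ _).measure_ne_top
  refine ⟨M / v, by positivity, fun u hu hmaps heq hui => ?_⟩
  set b : EuclideanSpace ℝ (Fin n) → ℝ := fun y => ζ y ^ (2 * 0 + 1 + 1) with hb
  have hbζ : tsupport b ⊆ tsupport ζ := by
    refine closure_mono fun x hx hx' => hx ?_
    simp [hb, hx']
  have hbs : tsupport b ⊆ closedBall 0 (15 / 16) := hbζ.trans hζs.subset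
  have hsub : closedBall (0 : EuclideanSpace ℝ (Fin n)) (15 / 16) ⊆ ball 0 1 :=
    closedBall_subset_ball (by norm_num)
  have hsub' : closedBall (0 : EuclideanSpace ℝ (Fin n)) (7 / 8) ⊆ ball 0 1 :=
    closedBall_subset_ball (by norm_num)
  have hbc : HasCompactSupport b :=
    (isCompact_closedBall _ _).of_isClosed_subset (isClosed_tsupport _) hbs
  obtain ⟨i1, i2, h⟩ := integral_mul_lap isOpen_ball hu (contDiff_infty.1 (hζ.pow _) 2) hbc
    (hbs.trans hsub)
  have hout : ∀ x ∉ ball (0 : EuclideanSpace ℝ (Fin n)) 1, x ∉ tsupport b := fun x hx h =>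
    hx (hsub (hbs h))
  have h1 : -∫ x, u x * lap b x ≤ M * ∫ x in ball 0 1, u x := by
    rw [← integral_neg, ← setIntegral_eq_integral_of_forall_compl_eq_zero (s := ball 0 1),
      ← integral_const_mul]
    · refine setIntegral_mono_on i1.neg.integrableOn (hui.const_mul _) measurableSet_ball
        fun x hx => ?_
      have hd := (hζd x).2
      rw [mul_zero, pow_zero, mul_one] at hd
      have := mul_le_mul_of_nonneg_left ((neg_le_abs _).trans hd) (hmaps hx).1
      rw [lap_eq_sum_partialDeriv]
      linarith
    · intro x hx
      have h2 : lap b x = 0 := by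
        rw [lap_eq_sum_partialDeriv]
        refine Finset.sum_eq_zero fun i _ => partialDeriv_eq_zero_of_notMem_tsupport i fun h => ?_
        exact hout x hx (tsupport_partialDeriv_subset b i h)
      rw [h2, mul_zero, neg_zero]
  have h2 : f 0 * v ≤ -∫ x, lap u x * b x := by
    have h3 : f 0 * v = ∫ x in closedBall (0 : EuclideanSpace ℝ (Fin n)) (7 / 8), f 0 := by
      rw [setIntegral_const, smul_eq_mul, mul_comm]
    rw [h3, ← integral_neg]
    have hnn : ∀ x, 0 ≤ -(lap u x * b x) := fun x => by
      by_cases hx : x ∈ ball 0 1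
      · rw [← neg_mul, heq x hx]
        refine mul_nonneg (hf0.trans ?_) (pow_nonneg (hζ01 x).1 _)
        exact hmono ⟨le_rfl, one_pos⟩ (hmaps hx) (hmaps hx).1
      · rw [image_eq_zero_of_notMem_tsupport (hout x hx), mul_zero, neg_zero]
    refine le_trans ?_ (setIntegral_le_integral (s := closedBall 0 (7 / 8)) i2.neg
      (Eventually.of_forall hnn))
    refine setIntegral_mono_on (integrableOn_const (isCompact_closedBall _ _).measure_ne_top)
      i2.neg.integrableOn measurableSet_closedBall fun x hx => ?_
    have hb1 : b x = 1 := by simp [hb, hζ1 x hx]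
    rw [hb1, mul_one, heq x (hsub' hx)]
    exact hmono ⟨le_rfl, one_pos⟩ (hmaps (hsub' hx)) (hmaps (hsub' hx)).1
  rw [div_mul_eq_mul_div, le_div_iff₀ hv0]
  rw [← h] at h2
  exact h2.trans h1

lemma integral_le_mul_self {f : ℝ → ℝ} (hmono : MonotoneOn f (Ico 0 1)) {t : ℝ}
    (ht : t ∈ Ico (0 : ℝ) 1) : ∫ s in (0 : ℝ)..t, f s ≤ f t * t := by
  have hsub : uIcc 0 t ⊆ Ico 0 1 := by
    rw [uIcc_of_le ht.1]
    exact fun s hs => ⟨hs.1, hs.2.trans_lt ht.2⟩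
  have hi : IntervalIntegrable f volume 0 t := (hmono.mono hsub).intervalIntegrable
  have h := intervalIntegral.integral_mono_on ht.1 hi
    (intervalIntegrable_const (c := f t)) fun s hs =>
      hmono ⟨hs.1, hs.2.trans_lt ht.2⟩ ht hs.2
  simpa [mul_comm] using h

end Conclusion

/-- Stable solutions stay away from the singular value `1` in the interior, uniformly. -/
lemma exists_uniform_lt_one {n : ℕ} (hn : 1 ≤ n) {f f' f'' : ℝ → ℝ} {γ t₀ a : ℝ}
    (hC2 : C2On01 f f' f'') (hf0 : ∀ t ∈ Ico (0:ℝ) 1, 0 ≤ f t)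
    (hf'0 : ∀ t ∈ Ico (0:ℝ) 1, 0 ≤ f' t)
    (hF : Tendsto (fun t => ∫ s in (0:ℝ)..t, f s) (𝓝[<] (1:ℝ)) atTop) (hγ : 0 < γ)
    (ht₀ : t₀ ∈ Ico (0 : ℝ) 1) (hCR : ∀ t ∈ Ico t₀ 1, 0 < f' t ∧ γ * f' t ^ 2 ≤ f t * f'' t)
    (ha : 1 < a) (haγ : (a - 1) ^ 2 < γ) (hna : (n : ℝ) < 2 * (1 + a)) :
    ∃ τ ∈ Ico (0 : ℝ) 1, ∀ u : EuclideanSpace ℝ (Fin n) → ℝ, ContDiffOn ℝ 2 u (ball 0 1) →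
      MapsTo u (ball 0 1) (Ico 0 1) → (∀ x ∈ ball 0 1, -lap u x = f (u x)) →
      StableSol f' u (ball 0 1) → ∀ x ∈ closedBall 0 (3 / 4), u x ≤ τ := by
  obtain ⟨E, hE⟩ := exists_energy_bound n hC2 hf0 hf'0 hγ ht₀ hCR ha haγ
  obtain ⟨C₁, hC₁, hV⟩ := exists_sq_le_deriv_mul_primitive hC2 hf0 hf'0 hγ ht₀ hCR
  obtain ⟨C, hC, hmax⟩ := exists_local_maximum_bound hn (q := 1 + a) (I := C₁ * E) (ρ := 7 / 8)
    (ρ' := 3 / 4) (by linarith) hna (by norm_num) (by norm_num) (by norm_num)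
  have hmono := monotoneOn_of_C2On01 hC2 hf'0
  obtain ⟨τ, hτ, hτ'⟩ := (mem_nhdsLT_iff_exists_mem_Ico_Ioo_subset
    (zero_lt_one (α := ℝ))).1 (hF.eventually_gt_atTop (C * E))
  refine ⟨τ, hτ, fun u hu hmaps heq hst x hx => ?_⟩
  by_contra! hlt
  have hsub : closedBall (0 : EuclideanSpace ℝ (Fin n)) (7 / 8) ⊆ ball 0 1 :=
    closedBall_subset_ball (by norm_num)
  have hx1 : x ∈ ball 0 1 := hsub (closedBall_subset_closedBall (by norm_num) hx)
  have hlarge : C * E < ∫ s in (0 : ℝ)..(u x), f s := hτ' ⟨hlt, (hmaps hx1).2⟩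
  set G : ℝ → ℝ := fun t => (∫ s in (0 : ℝ)..t, f s) + 1 with hG
  have hGd : ∀ t ∈ Ico (0 : ℝ) 1, HasDerivWithinAt G (f t) (Ico 0 1) t := fun t ht =>
    (hasDerivWithinAt_integral_Ico hC2.continuousOn ht).add_const 1
  have hGc : ContinuousOn G (Ico 0 1) := fun t ht => (hGd t ht).continuousWithinAt
  have hG1 : ∀ t ∈ Ico (0 : ℝ) 1, 1 ≤ G t := fun t ht => by
    have : 0 ≤ ∫ s in (0 : ℝ)..t, f s := intervalIntegral.integral_nonneg ht.1 fun s hs =>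
      hf0 s ⟨hs.1, hs.2.trans_lt ht.2⟩
    simp only [hG]
    linarith
  have hGf : ∀ t ∈ Ico (0 : ℝ) 1, G t ≤ f t + 1 := fun t ht => by
    have h1 := integral_le_mul_self hmono ht
    have h2 := mul_le_of_le_one_right (hf0 t ht) ht.2.le
    simp only [hG]
    linarith
  obtain ⟨cG, lG⟩ := contDiffOn_two_comp_Ico isOpen_ball hu hmaps hGd hC2.1 hC2.continuousOn_deriv
  have hcomp : ∀ {g : ℝ → ℝ}, ContinuousOn g (Ico 0 1) →
      ContinuousOn (fun x => g (u x)) (closedBall 0 (7 / 8)) := fun hg =>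
    (hg.comp hu.continuousOn hmaps).mono hsub
  have hVc : ContinuousOn (fun t => f t ^ 2 / G t) (Ico 0 1) :=
    (hC2.continuousOn.pow 2).div hGc fun t ht => (one_pos.trans_le (hG1 t ht)).ne'
  have hXc : ContinuousOn (fun t => (f' t + 1) * (f t + 1) ^ (2 * a)) (Ico 0 1) :=
    (hC2.continuousOn_deriv.add continuousOn_const).mul (hC2.continuousOn_rpow hf0 _)
  have hXi := (hcomp hXc).integrableOn_compact (μ := volume) (isCompact_closedBall _ _)
  have hX1 : ∀ t ∈ Ico (0 : ℝ) 1, f t + 1 ≤ (f' t + 1) * (f t + 1) ^ (2 * a) := fun t ht => by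
    have h1 : (f t + 1) ^ (1 : ℝ) ≤ (f t + 1) ^ (2 * a) :=
      Real.rpow_le_rpow_of_exponent_le (by linarith [hf0 t ht]) (by linarith)
    rw [Real.rpow_one] at h1
    have h2 := hf'0 t ht
    have h3 := hf0 t ht
    have h4 : 0 ≤ f' t * (f t + 1) ^ (2 * a) := mul_nonneg h2 (Real.rpow_nonneg (by linarith) _)
    linarith
  have hVq : ∀ t ∈ Ico (0 : ℝ) 1,
      (f t ^ 2 / G t) ^ (1 + a) ≤ C₁ * ((f' t + 1) * (f t + 1) ^ (2 * a)) := fun t ht => by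
    have hg := hG1 t ht
    have hf := hf0 t ht
    have h0 : 0 ≤ f t ^ 2 / G t := by positivity
    have h1 : f t ^ 2 / G t ≤ C₁ * (f' t + 1) := (div_le_iff₀ (by linarith)).2 (hV t ht)
    have h2 : f t ^ 2 / G t ≤ (f t + 1) ^ 2 :=
      (div_le_self (sq_nonneg _) hg).trans (pow_le_pow_left₀ hf (by linarith) 2)
    have h3 : (f t ^ 2 / G t) ^ a ≤ (f t + 1) ^ (2 * a) := by
      refine (Real.rpow_le_rpow h0 h2 (by linarith)).trans_eq ?_
      rw [Real.rpow_mul (by linarith), Real.rpow_two]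
    rw [Real.rpow_add' h0 (by linarith), Real.rpow_one, ← mul_assoc]
    exact mul_le_mul h1 h3 (Real.rpow_nonneg h0 _) (by have := hf'0 t ht; positivity)
  have hw := hmax (fun x => G (u x)) (fun x => f (u x) ^ 2 / G (u x)) (ball 0 1) isOpen_ball cG hsub
    (hcomp hVc) (fun y hy => ?_) ?_ x hx
  · have h1 : ∫ y in closedBall 0 (7 / 8), G (u y) ≤ E := by
      refine le_trans ?_ (hE u hu hmaps heq hst)
      refine setIntegral_mono_on ((hcomp hGc).integrableOn_compact (isCompact_closedBall _ _)) hXi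
        measurableSet_closedBall fun y hy => ?_
      exact (hGf _ (hmaps (hsub hy))).trans (hX1 _ (hmaps (hsub hy)))
    have h2 := mul_le_mul_of_nonneg_left h1 hC
    simp only [hG] at hw h2
    linarith
  · have hy1 := hsub hy
    have hg := hG1 _ (hmaps hy1)
    refine ⟨by positivity, by linarith, ?_⟩
    have h1 : 0 ≤ f' (u y) * ∑ i, partialDeriv i u y ^ 2 :=
      mul_nonneg (hf'0 _ (hmaps hy1)) (Finset.sum_nonneg fun i _ => sq_nonneg _)
    have h2 : lap u y = -f (u y) := by linarith [heq y hy1]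
    rw [lG y hy1, h2, div_mul_cancel₀ _ (by linarith : G (u y) ≠ 0)]
    linarith
  · refine le_trans ?_ (mul_le_mul_of_nonneg_left (hE u hu hmaps heq hst) hC₁.le)
    rw [← integral_const_mul]
    refine setIntegral_mono_on ?_ (hXi.const_mul _) measurableSet_closedBall
      fun y hy => hVq _ (hmaps (hsub hy))
    exact ((hcomp hVc).rpow_const fun _ _ => Or.inr (by linarith)).integrableOn_compact
      (isCompact_closedBall _ _)

/-- Interior estimate under the weaker Crandall–Rabinowitz condition `γ̲ > 0`:
if `γ̲ := liminf_{t→1⁻} f f''/f'² > 0` and `n < 4 + 2√γ̲`, then `F(u(x)) ≤ C ‖u‖²_{L¹(B₁)}`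
on `B_{1/2}`, with `C = C(n, f)`. (The hypothesis `n < 4 + 2√γ̲` with `γ̲ > 0` is expressed by
the existence of a real `γ > 0` below the liminf with `n < 4 + 2√γ`.) -/
theorem stmt1 (n : ℕ) (hn : 1 ≤ n) (f f' f'' : ℝ → ℝ)
    (hC2 : C2On01 f f' f'')
    (hf0 : ∀ t ∈ Ico (0:ℝ) 1, 0 ≤ f t)
    (hf'0 : ∀ t ∈ Ico (0:ℝ) 1, 0 ≤ f' t)
    (hF : Tendsto (fun t => ∫ s in (0:ℝ)..t, f s) (𝓝[<] (1:ℝ)) atTop)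
    (hf'pos : ∀ᶠ t in 𝓝[<] (1:ℝ), 0 < f' t)
    (hγ : ∃ γ : ℝ, 0 < γ ∧
      (γ : EReal) ≤ Filter.liminf (fun t => ((f t * f'' t / f' t ^ 2 : ℝ) : EReal)) (𝓝[<] (1:ℝ)) ∧
      (n : ℝ) < 4 + 2 * Real.sqrt γ) :
    ∃ C : ℝ, 0 < C ∧
      ∀ u : EuclideanSpace ℝ (Fin n) → ℝ,
        ContDiffOn ℝ 2 u (closure (ball (0:EuclideanSpace ℝ (Fin n)) 1)) →
        (∀ x ∈ closure (ball (0:EuclideanSpace ℝ (Fin n)) 1), 0 ≤ u x ∧ u x < 1) →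
        (∀ x ∈ ball (0:EuclideanSpace ℝ (Fin n)) 1, -lap u x = f (u x)) →
        StableSol f' u (ball 0 1) →
        ∀ x ∈ ball (0:EuclideanSpace ℝ (Fin n)) (1/2),
          (∫ s in (0:ℝ)..(u x), f s) ≤
            C * (∫ y in ball (0:EuclideanSpace ℝ (Fin n)) 1, u y) ^ 2 := by
  obtain ⟨a, γ, t₀, ha, hna, hγ0, haγ, ht₀, hCR⟩ := exists_exponent_threshold hf'pos hγ
  obtain ⟨τ, hτ, hlt⟩ := exists_uniform_lt_one hn hC2 hf0 hf'0 hF hγ0 ht₀ hCR ha haγ hna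
  have hmono := monotoneOn_of_C2On01 hC2 hf'0
  have hz : (0 : ℝ) ∈ Ico (0 : ℝ) 1 := ⟨le_rfl, one_pos⟩
  have hf00 := hf0 0 hz
  obtain ⟨C₁, hC₁, hzero⟩ := exists_apply_zero_le n hmono hf00
  have hτsub : Icc 0 τ ⊆ Ico (0 : ℝ) 1 := fun t ht => ⟨ht.1, ht.2.trans_lt hτ.2⟩
  obtain ⟨M, hM⟩ := isCompact_Icc.exists_bound_of_continuousOn (hC2.continuousOn_deriv.mono hτsub)
  set L := max 1 M with hL
  have hL1 : 1 ≤ L := le_max_left _ _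
  have hlin : ∀ t ∈ Icc 0 τ, f t ≤ L * (t + f 0) := fun t ht => by
    have h1 := (convex_Icc 0 τ).norm_image_sub_le_of_norm_hasDerivWithin_le
      (fun s hs => (hC2.1 s (hτsub hs)).mono hτsub) hM ⟨le_rfl, hτ.1⟩ ht
    rw [Real.norm_eq_abs, sub_zero, Real.norm_of_nonneg ht.1] at h1
    have h2 := (le_abs_self _).trans h1
    have h3 := mul_le_mul_of_nonneg_right (le_max_right 1 M) ht.1
    have h4 := mul_le_mul_of_nonneg_right hL1 hf00
    linarith
  set v := volume.real (closedBall (0 : EuclideanSpace ℝ (Fin n)) (3 / 4)) with hv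
  have hv0 : 0 ≤ v := measureReal_nonneg
  obtain ⟨C₂, hC₂, hmax⟩ := exists_local_maximum_bound hn (q := 1 + a) (I := v * L ^ (1 + a))
    (ρ := 3 / 4) (ρ' := 1 / 2) (by linarith) hna (by norm_num) (by norm_num) (by norm_num)
  refine ⟨L * (C₂ * (1 + v * C₁)) ^ 2 + 1, by positivity, fun u hu hu01 heq hst x hx => ?_⟩
  have hmaps : MapsTo u (ball 0 1) (Ico 0 1) := fun y hy => hu01 y (subset_closure hy)
  have hui : IntegrableOn u (ball 0 1) := by
    refine IntegrableOn.mono_set ?_ subset_closure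
    exact hu.continuousOn.integrableOn_compact
      ((isCompact_closedBall (0 : EuclideanSpace ℝ (Fin n)) 1).of_isClosed_subset isClosed_closure
        closure_ball_subset_closedBall)
  have hu2 : ContDiffOn ℝ 2 u (ball 0 1) := hu.mono subset_closure
  have hsub : closedBall (0 : EuclideanSpace ℝ (Fin n)) (3 / 4) ⊆ ball 0 1 :=
    closedBall_subset_ball (by norm_num)
  set J := ∫ y in ball 0 1, u y with hJ
  have hJ0 : 0 ≤ J := setIntegral_nonneg measurableSet_ball fun y hy => (hmaps hy).1
  have hf0J : f 0 ≤ C₁ * J := hzero u hu2 hmaps heq hui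
  have huτ : ∀ y ∈ closedBall 0 (3 / 4), u y ∈ Icc 0 τ := fun y hy =>
    ⟨(hmaps (hsub hy)).1, hlt u hu2 hmaps heq hst y hy⟩
  have hlap : ∀ y, lap (fun y => u y + f 0) y = lap u y := fun y => by
    simp only [lap, fderiv_add_const]
  have hw := hmax (fun y => u y + f 0) (fun _ => L) (ball 0 1) isOpen_ball
    (hu2.add contDiffOn_const) hsub continuousOn_const (fun y hy => ⟨by linarith,
      add_nonneg (huτ y hy).1 hf00, ?_⟩) (by rw [setIntegral_const, smul_eq_mul]) x
    (ball_subset_closedBall hx)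
  · have hx2 : x ∈ closedBall 0 (3 / 4) :=
      closedBall_subset_closedBall (by norm_num) (ball_subset_closedBall hx)
    have hx1 := hsub hx2
    have h1 : ∫ y in closedBall 0 (3 / 4), (u y + f 0) ≤ (1 + v * C₁) * J := by
      have i0 : IntegrableOn (fun _ : EuclideanSpace ℝ (Fin n) => f 0) (closedBall 0 (3 / 4)) :=
        integrableOn_const (isCompact_closedBall _ _).measure_ne_top
      rw [integral_add (hui.mono_set hsub) i0, setIntegral_const, smul_eq_mul]
      have h2 : ∫ y in closedBall 0 (3 / 4), u y ≤ J := by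
        refine setIntegral_mono_set hui ?_ hsub.eventuallyLE
        filter_upwards [ae_restrict_mem measurableSet_ball] with y hy using (hmaps hy).1
      have h3 := mul_le_mul_of_nonneg_left hf0J hv0
      linarith
    have h2 : u x + f 0 ≤ C₂ * (1 + v * C₁) * J := by
      have := mul_le_mul_of_nonneg_left h1 hC₂
      linarith
    have hux := huτ x hx2
    have h3 : f (u x) * u x ≤ L * (u x + f 0) * (u x + f 0) :=
      mul_le_mul (hlin _ hux) (by linarith) hux.1
        (mul_nonneg (by linarith) (add_nonneg hux.1 hf00))
    have h4 : (u x + f 0) ^ 2 ≤ (C₂ * (1 + v * C₁) * J) ^ 2 :=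
      pow_le_pow_left₀ (add_nonneg hux.1 hf00) h2 2
    have h5 := mul_le_mul_of_nonneg_left h4 (by linarith : 0 ≤ L)
    calc ∫ s in (0 : ℝ)..(u x), f s ≤ f (u x) * u x := integral_le_mul_self hmono (hmaps hx1)
      _ ≤ L * (C₂ * (1 + v * C₁) * J) ^ 2 := by linarith
      _ ≤ _ := by linarith [sq_nonneg J]
  · rw [hlap, heq y (hsub hy)]
    exact hlin _ (huτ y hy)
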